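/- Let n ∈ {6, 7, 8} and let h ∈ ℂ[X₀,…,Xₙ] be an irreducible homogeneous polynomial of degree n − 2 defining a totally invariant hypersurface X = {h = 0} ⊂ ℙⁿ(ℂ). Then the singular locus of X has dimension n − 2 or n − 3; in particular the Jacobian ring J(h) has Krull dimension ≥ n − 2. -/

import Mathlib

open MvPolynomial

/-- `F` is an endomorphism of `ℙ^{N-1}(ℂ)` of algebraic degree `q`: a tuple of `N`
homogeneous polynomials of degree `q` in `N` variables whose only common zero in `ℂ^N`
is the origin. -/
def IsEndo (N q : ℕ) (F : Fin N → MvPolynomial (Fin N) ℂ) : Prop :=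
  (∀ i, (F i).IsHomogeneous q) ∧
    ∀ x : Fin N → ℂ, (∀ i, eval x (F i) = 0) → x = 0

/-- The hypersurface `{h = 0} ⊂ ℙ^{N-1}(ℂ)` is totally invariant: there is a non-trivial
endomorphism `F` (of algebraic degree `q ≥ 2`) and `λ ≠ 0` with `h(F₀,…,F_{N-1}) = λ·h^q`. -/
def IsTotallyInvariant (N : ℕ) (h : MvPolynomial (Fin N) ℂ) : Prop :=
  ∃ q, 2 ≤ q ∧ ∃ F : Fin N → MvPolynomial (Fin N) ℂ, IsEndo N q F ∧
    ∃ lam : ℂ, lam ≠ 0 ∧ aeval F h = C lam * h ^ q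

/-- The Jacobian ideal `(h, ∂h/∂X₀, …, ∂h/∂X_{N-1})`. -/
noncomputable def jacobianIdeal (N : ℕ) (h : MvPolynomial (Fin N) ℂ) : Ideal (MvPolynomial (Fin N) ℂ) :=
  Ideal.span (insert h (Set.range fun i => pderiv i h))

lemma ti_alg_snd {k0 K : Type*} [Field k0] [Field K] [CharZero k0] [Algebra k0 K]
    (Ψ : K →+* DualNumber K) (hfst : ∀ x, (Ψ x).fst = x)
    (hk : ∀ a : k0, (Ψ (algebraMap k0 K a)).snd = 0) (x : K) (hx : IsAlgebraic k0 x) : (Ψ x).snd = 0 := by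
  have hsep : (minpoly k0 x).Separable := (minpoly.irreducible hx.isIntegral).separable
  have h0 : Polynomial.aeval x (minpoly k0 x) = 0 := minpoly.aeval _ _
  have h1 : Polynomial.aeval x (Polynomial.derivative (minpoly k0 x)) ≠ 0 :=
    hsep.aeval_derivative_ne_zero h0
  have key : ∀ P : Polynomial k0, (Ψ (Polynomial.aeval x P)).snd
      = Polynomial.aeval x (Polynomial.derivative P) * (Ψ x).snd := by
    intro P
    induction P using Polynomial.induction_on' with
    | add p q hp hq => simp [map_add, hp, hq, add_mul]
    | monomial n a =>
      have : ∀ n : ℕ, (Ψ x ^ n).snd = n * x ^ (n - 1) * (Ψ x).snd := by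
        intro n
        rw [TrivSqZeroExt.snd_pow, hfst]
        simp [mul_assoc]
      simp only [Polynomial.aeval_monomial, map_mul, map_pow, Polynomial.derivative_monomial,
        TrivSqZeroExt.snd_mul, this]
      rw [hk, hfst]
      simp [mul_assoc]
  have := key (minpoly k0 x)
  rw [h0] at this
  simp only [map_zero, TrivSqZeroExt.snd_zero] at this
  exact (mul_eq_zero.1 this.symm).resolve_left h1

lemma ti_exists_dual {σ K : Type*} [Fintype σ] [Field K] [Algebra (MvPolynomial σ ℂ) K]
    [IsFractionRing (MvPolynomial σ ℂ) K] (v : σ → K) :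
    ∃ Ψ : K →+* DualNumber K,
      (∀ x, (Ψ x).fst = x) ∧ ∀ f : MvPolynomial σ ℂ,
        (Ψ (algebraMap _ _ f)).snd = ∑ a, algebraMap _ K (pderiv a f) * v a := by
  classical
  let φ : MvPolynomial σ ℂ →+* DualNumber K :=
    eval₂Hom ((TrivSqZeroExt.inlHom K K).comp ((algebraMap (MvPolynomial σ ℂ) K).comp C))
      (fun a => TrivSqZeroExt.inl (algebraMap _ K (X a : MvPolynomial σ ℂ)) + TrivSqZeroExt.inr (v a))
  have hfst : ∀ f, (φ f).fst = algebraMap _ K f := by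
    intro f
    have : ((TrivSqZeroExt.fstHom K K K).toRingHom).comp φ = algebraMap _ K := by
      apply MvPolynomial.ringHom_ext
      · intro r; simp [φ]
      · intro i; simp [φ]
    exact congrArg (fun g => g f) this
  have hsnd : ∀ f, (φ f).snd = ∑ a, algebraMap _ K (pderiv a f) * v a := by
    intro f
    induction f using MvPolynomial.induction_on with
    | C a => simp [φ]
    | add p q hp hq => simp [map_add, hp, hq, add_mul, Finset.sum_add_distrib]
    | mul_X p i hp =>
      rw [map_mul, TrivSqZeroExt.snd_mul, hp, hfst, hfst]
      have : (φ (X i)).snd = v i := by simp [φ]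
      rw [this]
      simp only [Derivation.leibniz, pderiv_X, smul_eq_mul, map_add, map_mul, add_mul,
        Finset.sum_add_distrib, MulOpposite.smul_eq_mul_unop, MulOpposite.unop_op]
      congr 1
      · rw [Finset.sum_eq_single i]
        · simp
        · intro b _ hb; simp [hb.symm]
        · simp
      · rw [Finset.sum_mul]
        exact Finset.sum_congr rfl fun _ _ => by ring
  have hu : ∀ y : nonZeroDivisors (MvPolynomial σ ℂ), IsUnit (φ y) := by
    intro y
    rw [TrivSqZeroExt.isUnit_iff_isUnit_fst, hfst]
    exact IsLocalization.map_units K y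
  refine ⟨IsLocalization.lift hu, ?_, ?_⟩
  · intro x
    have : ((TrivSqZeroExt.fstHom K K K).toRingHom).comp (IsLocalization.lift hu)
        = RingHom.id K := by
      apply IsLocalization.ringHom_ext (nonZeroDivisors (MvPolynomial σ ℂ))
      ext f
      · simp [hfst]
      · simp [hfst]
    exact congrArg (fun g => g x) this
  · intro f
    rw [IsLocalization.lift_eq]
    exact hsnd f

lemma ti_indep_aux {k0 K τ ι ρ : Type*} [Field k0] [Field K] [Algebra k0 K] [Infinite K]
    [Fintype τ] (Φ : ι → MvPolynomial τ k0) (w : τ → K)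
    (hΦ : ∀ j, aeval w (Φ j) = 0)
    (hJ : ∀ z : ι → K, ∃ v : τ → K, ∀ j, ∑ a, aeval w (pderiv a (Φ j)) * v a = z j)
    (b : ρ → MvPolynomial τ k0) (hb : LinearIndependent k0 (fun i => aeval w (b i)))
    (s : Finset ρ) (c : ρ → MvPolynomial ι k0) (h0 : ∑ i ∈ s, b i * aeval Φ (c i) = 0) :
    ∀ k : ℕ, ∀ i ∈ s, homogeneousComponent k (c i) = 0 := by
  classical
  intro k
  induction k using Nat.strong_induction_on with
  | _ k ih =>
  have hdeg : ∀ i ∈ s, ∀ α ∈ (c i).support, k ≤ α.degree := by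
    intro i hi α hα
    by_contra hlt
    have := ih _ (not_le.1 hlt) i hi
    have h2 : coeff α (homogeneousComponent α.degree (c i)) = 0 := by rw [this]; simp
    rw [coeff_homogeneousComponent, if_pos rfl] at h2
    exact (mem_support_iff.1 hα) h2
  have hmain : ∀ z : ι → K, ∑ i ∈ s, aeval w (b i) * aeval z (homogeneousComponent k (c i)) = 0 := by
    intro z
    obtain ⟨v, hv⟩ := hJ z
    let ψ : MvPolynomial τ k0 →ₐ[k0] Polynomial K :=
      aeval (fun a => Polynomial.C (w a) + Polynomial.X * Polynomial.C (v a))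
    have hψ0 : ∀ f, (ψ f).coeff 0 = aeval w f := by
      intro f
      induction f using MvPolynomial.induction_on with
      | C a => simp [ψ, Polynomial.algebraMap_apply]
      | add p q hp hq => simp [map_add, hp, hq]
      | mul_X p i hp =>
        rw [map_mul, Polynomial.mul_coeff_zero, hp, map_mul]
        simp [ψ]
    have hψ1 : ∀ f, (ψ f).coeff 1 = ∑ a, aeval w (pderiv a f) * v a := by
      intro f
      induction f using MvPolynomial.induction_on with
      | C a => simp [ψ, Polynomial.algebraMap_apply]
      | add p q hp hq => simp [map_add, hp, hq, add_mul, Finset.sum_add_distrib]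
      | mul_X p i hp =>
        rw [map_mul, Polynomial.mul_coeff_one, hp, hψ0, hψ0]
        have : (ψ (X i)).coeff 1 = v i := by simp [ψ, Polynomial.coeff_C]
        rw [this]
        simp only [Derivation.leibniz, pderiv_X, smul_eq_mul, map_add, map_mul, add_mul,
          Finset.sum_add_distrib]
        congr 1
        · rw [Finset.sum_eq_single i]
          · simp
          · intro b _ hb; simp [hb.symm]
          · simp
        · rw [Finset.sum_mul]
          exact Finset.sum_congr rfl fun _ _ => by ring
    let χ : ι → Polynomial K := fun j => (ψ (Φ j)).divX
    have hχ : ∀ j, ψ (Φ j) = Polynomial.X * χ j := by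
      intro j
      have := Polynomial.X_mul_divX_add (ψ (Φ j))
      rw [hψ0, hΦ] at this
      simpa using this.symm
    have hχ0 : ∀ j, (χ j).eval 0 = z j := by
      intro j
      rw [← Polynomial.coeff_zero_eq_eval_zero]
      change (ψ (Φ j)).divX.coeff 0 = _
      rw [Polynomial.coeff_divX, hψ1, hv]
    let E : ρ → Polynomial K := fun i => ∑ α ∈ (c i).support,
      Polynomial.C (algebraMap k0 K (coeff α (c i))) * Polynomial.X ^ (α.degree - k)
        * α.prod (fun j e => χ j ^ e)
    have hE : ∀ i ∈ s, ψ (aeval Φ (c i)) = Polynomial.X ^ k * E i := by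
      intro i hi
      have e1 : ψ (aeval Φ (c i)) = aeval (fun j => ψ (Φ j)) (c i) := by
        rw [← AlgHom.comp_apply, comp_aeval]
      rw [e1, aeval_def, eval₂_eq, Finset.mul_sum]
      refine Finset.sum_congr rfl fun α hα => ?_
      have hk := hdeg i hi α hα
      simp only [hχ, mul_pow, Finset.prod_mul_distrib, Finset.prod_pow_eq_pow_sum]
      have e2 : ∑ i ∈ α.support, α i = k + (α.degree - k) := by
        rw [Nat.add_sub_cancel' hk]; rfl
      rw [e2, pow_add, Polynomial.algebraMap_apply, Finsupp.prod]
      ring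
    have h1 : ∑ i ∈ s, ψ (b i) * E i = 0 := by
      have h2 := congrArg ψ h0
      rw [map_sum, map_zero] at h2
      have h3 : Polynomial.X ^ k * ∑ i ∈ s, ψ (b i) * E i = 0 := by
        rw [← h2, Finset.mul_sum]
        refine Finset.sum_congr rfl fun i hi => ?_
        rw [map_mul, hE i hi]; ring
      exact (mul_eq_zero.1 h3).resolve_left (pow_ne_zero _ Polynomial.X_ne_zero)
    have h2 := congrArg (Polynomial.eval 0) h1
    rw [Polynomial.eval_finsetSum, Polynomial.eval_zero] at h2
    rw [← h2]
    refine Finset.sum_congr rfl fun i hi => ?_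
    rw [Polynomial.eval_mul, ← Polynomial.coeff_zero_eq_eval_zero, hψ0]
    congr 1
    simp only [E]
    rw [Polynomial.eval_finsetSum, homogeneousComponent_apply, map_sum, Finset.sum_filter]
    refine Finset.sum_congr rfl fun α hα => ?_
    have hk := hdeg i hi α hα
    split_ifs with hd
    · rw [hd]
      simp only [aeval_monomial, Finsupp.prod, Polynomial.eval_mul, Polynomial.eval_C,
        Polynomial.eval_pow, Polynomial.eval_prod, hχ0]
      simp
    · have : α.degree - k ≠ 0 := by omega
      simp [this]
  have hG : ∑ i ∈ s, C (aeval w (b i)) * map (algebraMap k0 K) (homogeneousComponent k (c i)) = 0 := by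
    apply MvPolynomial.funext
    intro z
    rw [map_sum, map_zero, ← hmain z]
    refine Finset.sum_congr rfl fun i _ => ?_
    rw [map_mul, eval_C, eval_map, ← aeval_def]
  intro i hi
  ext α
  rw [coeff_zero]
  have h3 := congrArg (coeff α) hG
  rw [coeff_sum, coeff_zero] at h3
  refine linearIndependent_iff'.1 hb s (fun i => coeff α (homogeneousComponent k (c i))) ?_ i hi
  rw [← h3]
  refine Finset.sum_congr rfl fun i _ => ?_
  rw [coeff_C_mul, coeff_map, Algebra.smul_def, mul_comm]

lemma ti_indep {k0 K τ ι ρ : Type*} [Field k0] [Field K] [Algebra k0 K] [Infinite K]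
    [Fintype τ] (Φ : ι → MvPolynomial τ k0) (w : τ → K)
    (hΦ : ∀ j, aeval w (Φ j) = 0)
    (hJ : ∀ z : ι → K, ∃ v : τ → K, ∀ j, ∑ a, aeval w (pderiv a (Φ j)) * v a = z j)
    (b : ρ → MvPolynomial τ k0) (hb : LinearIndependent k0 (fun i => aeval w (b i))) :
    LinearIndependent k0 (fun x : ρ × (ι →₀ ℕ) => b x.1 * aeval Φ (monomial x.2 (1 : k0))) := by
  classical
  rw [linearIndependent_iff']
  intro S g hS x hx
  let s := S.image Prod.fst
  let t := S.image Prod.snd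
  let c : ρ → MvPolynomial ι k0 := fun i =>
    ∑ α ∈ t, if (i, α) ∈ S then monomial α (g (i, α)) else 0
  have hc : ∑ i ∈ s, b i * aeval Φ (c i) = 0 := by
    rw [← hS]
    have hsub : S ⊆ s ×ˢ t := by
      intro y hy
      exact Finset.mem_product.2 ⟨Finset.mem_image_of_mem _ hy, Finset.mem_image_of_mem _ hy⟩
    have e1 : ∑ y ∈ S, g y • (b y.1 * aeval Φ (monomial y.2 (1 : k0)))
        = ∑ y ∈ s ×ˢ t, if y ∈ S then g y • (b y.1 * aeval Φ (monomial y.2 (1 : k0))) else 0 := by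
      rw [← Finset.sum_filter]
      congr 1
      ext y; simp only [Finset.mem_filter]; exact ⟨fun h => ⟨hsub h, h⟩, fun h => h.2⟩
    rw [e1, Finset.sum_product]
    refine Finset.sum_congr rfl fun i _ => ?_
    simp only [c, map_sum, Finset.mul_sum]
    refine Finset.sum_congr rfl fun α _ => ?_
    split_ifs
    · have : (monomial α (g (i, α)) : MvPolynomial ι k0) = g (i, α) • monomial α 1 := by
        rw [smul_monomial]; simp
      rw [this, map_smul, mul_smul_comm]
    · simp
  have h1 := ti_indep_aux Φ w hΦ hJ b hb s c hc x.2.degree x.1 (Finset.mem_image_of_mem _ hx)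
  have h2 := congrArg (coeff x.2) h1
  rw [coeff_homogeneousComponent, if_pos rfl, coeff_zero] at h2
  simp only [c, coeff_sum] at h2
  rw [Finset.sum_eq_single x.2] at h2
  · simpa [hx] using h2
  · intro α _ hne
    split_ifs
    · rw [coeff_monomial, if_neg hne]
    · simp
  · intro hn
    exact absurd (Finset.mem_image_of_mem _ hx) hn

open Classical in
/-- Exponents of degree at most `K`. -/
noncomputable def tiLow (τ : Type*) [Fintype τ] (K : ℕ) : Finset (τ →₀ ℕ) :=
  (Finset.range (K + 1)).biUnion (fun n => (Finset.univ : Finset τ).finsuppAntidiag n)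

lemma mem_tiLow {τ : Type*} [Fintype τ] (K : ℕ) (α : τ →₀ ℕ) :
    α ∈ tiLow τ K ↔ α.degree ≤ K := by
  classical
  simp [tiLow, Finset.mem_finsuppAntidiag, Finsupp.degree_eq_sum]

lemma card_tiLow (τ : Type*) [Fintype τ] (K : ℕ) :
    (tiLow τ K).card = (K + Fintype.card τ).choose (Fintype.card τ) := by
  classical
  have h1 : (tiLow τ K).card = ∑ n ∈ Finset.range (K + 1), (Fintype.card τ).multichoose n := by
    rw [tiLow, Finset.card_biUnion]
    · refine Finset.sum_congr rfl fun n _ => ?_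
      rw [Finset.card_finsuppAntidiag_nat_eq_multichoose]; rfl
    · intro a _ b _ hab
      rw [Function.onFun, Finset.disjoint_left]
      intro x hx hy
      rw [Finset.mem_finsuppAntidiag] at hx hy
      exact hab (hx.1.symm.trans hy.1)
  have h2 : ∀ K, ∑ n ∈ Finset.range (K + 1), (Fintype.card τ).multichoose n
      = (Fintype.card τ + 1).multichoose K := by
    intro K
    induction K with
    | zero => simp
    | succ k ih => rw [Finset.sum_range_succ, ih, Nat.multichoose_succ_succ, add_comm]
  rw [h1, h2, Nat.multichoose_eq]
  have : Fintype.card τ + 1 + K - 1 = K + Fintype.card τ := by omega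
  rw [this, Nat.choose_symm_add]

lemma ti_choose_ge (T N : ℕ) : (T + 1) ^ N ≤ (T + N).choose N * N.factorial := by
  have h := Nat.pow_sub_le_descFactorial (T + N) N
  rw [Nat.descFactorial_eq_factorial_mul_choose] at h
  have e : T + N + 1 - N = T + 1 := by omega
  rw [e] at h
  rw [mul_comm]; exact h

lemma ti_choose_le (T N : ℕ) : (T + N).choose N * N.factorial ≤ (T + N) ^ N := by
  have h := Nat.descFactorial_le_pow (T + N) N
  rw [Nat.descFactorial_eq_factorial_mul_choose] at h
  rw [mul_comm]; exact h

lemma ti_sum_pow (n K : ℕ) : (n + 1) * ∑ j ∈ Finset.range K, j ^ n ≤ K ^ (n + 1) := by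
  induction K with
  | zero => simp
  | succ k ih =>
    rw [Finset.sum_range_succ, mul_add]
    have : k ^ (n + 1) + (n + 1) * k ^ n ≤ (k + 1) ^ (n + 1) := by
      clear ih
      induction n with
      | zero => simp
      | succ n ih =>
        calc k ^ (n + 1 + 1) + (n + 1 + 1) * k ^ (n + 1)
            ≤ (k ^ (n + 1) + (n + 1) * k ^ n) * (k + 1) := by
              have : 0 ≤ (n + 1) * k ^ n := Nat.zero_le _
              ring_nf at this ⊢
              omega
          _ ≤ (k + 1) ^ (n + 1) * (k + 1) := Nat.mul_le_mul_right _ ih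
    omega

/-- The index type of the variables. -/
abbrev TiVar (m : ℕ) := Fin 3 ⊕ (Fin m ⊕ Unit)

lemma ti_card_bound (m Q d T B c : ℕ) (hdQ : d ≤ Q) (hc : d * T + B + 3 ≤ Q * c) (hmc : m ≤ c)
    (X : Finset (TiVar m →₀ ℕ))
    (hX1 : ∀ x ∈ X, ∑ k, x (Sum.inr (Sum.inl k)) + x (Sum.inr (Sum.inr ())) ≤ T)
    (hX2 : ∀ x ∈ X, ∑ i, x (Sum.inl i) + (Q - d) * x (Sum.inr (Sum.inr ())) ≤ Q * T + B) :
    X.card * (6 * m.factorial) * (m + 4) ≤ Q ^ 3 * (T + 1 + c) ^ (m + 4) := by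
  classical
  let Y : Finset (Σ _ : ℕ, (Fin m →₀ ℕ) × (Fin 3 →₀ ℕ)) :=
    (Finset.range (T + 1)).sigma (fun s => tiLow (Fin m) s ×ˢ tiLow (Fin 3) (Q * s + d * T + B))
  let φ : (TiVar m →₀ ℕ) → (Σ _ : ℕ, (Fin m →₀ ℕ) × (Fin 3 →₀ ℕ)) := fun x =>
    ⟨T - x (Sum.inr (Sum.inr ())),
      (Finsupp.equivFunOnFinite.symm (fun k => x (Sum.inr (Sum.inl k))),
       Finsupp.equivFunOnFinite.symm (fun i => x (Sum.inl i)))⟩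
  have hφ : ∀ x ∈ X, φ x ∈ Y := by
    intro x hx
    have h1 := hX1 x hx
    have h2 := hX2 x hx
    simp only [Y, φ, Finset.mem_sigma, Finset.mem_range, Finset.mem_product, mem_tiLow,
      Finsupp.degree_eq_sum, Finsupp.equivFunOnFinite_symm_apply_apply]
    refine ⟨by omega, by omega, ?_⟩
    obtain ⟨s, hs⟩ := Nat.exists_eq_add_of_le (show x (Sum.inr (Sum.inr ())) ≤ T by omega)
    obtain ⟨e, he⟩ := Nat.exists_eq_add_of_le hdQ
    generalize x (Sum.inr (Sum.inr ())) = t at *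
    have e1 : T - t = s := by omega
    have e2 : Q - d = e := by omega
    rw [e1]
    rw [e2] at h2
    have : Q * T + B = Q * s + d * t + e * t + B := by rw [hs, he]; ring
    have h3 : d * t ≤ d * T := Nat.mul_le_mul_left _ (by omega)
    omega
  have hinj : Set.InjOn φ X := by
    intro x hx y hy hxy
    have h1 := hX1 x hx
    have h2 := hX1 y hy
    simp only [φ, Sigma.mk.injEq, heq_eq_eq, Prod.mk.injEq, EmbeddingLike.apply_eq_iff_eq] at hxy
    obtain ⟨ha, hb, hc⟩ := hxy
    ext v
    rcases v with i | k | u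
    · exact congrFun hc i
    · exact congrFun hb k
    · cases u; change x (Sum.inr (Sum.inr ())) = y (Sum.inr (Sum.inr ())); omega
  have hcard := Finset.card_le_card_of_injOn φ hφ hinj
  have hY : Y.card = ∑ s ∈ Finset.range (T + 1),
      (s + m).choose m * (Q * s + d * T + B + 3).choose 3 := by
    simp only [Y, Finset.card_sigma, Finset.card_product, card_tiLow, Fintype.card_fin]
  rw [hY] at hcard
  have h6 : ∀ s, (s + m).choose m * (Q * s + d * T + B + 3).choose 3 * (6 * m.factorial)
      ≤ Q ^ 3 * (s + c) ^ (m + 3) := by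
    intro s
    have a1 := ti_choose_le s m
    have a2 := ti_choose_le (Q * s + d * T + B) 3
    have e6 : Nat.factorial 3 = 6 := rfl
    rw [e6] at a2
    calc _ = ((s + m).choose m * m.factorial) * ((Q * s + d * T + B + 3).choose 3 * 6) := by ring
      _ ≤ (s + m) ^ m * (Q * s + d * T + B + 3) ^ 3 := Nat.mul_le_mul a1 a2
      _ ≤ (s + c) ^ m * (Q * (s + c)) ^ 3 := by
          apply Nat.mul_le_mul
          · exact Nat.pow_le_pow_left (by omega) _
          · apply Nat.pow_le_pow_left
            rw [mul_add]; omega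
      _ = _ := by ring
  calc X.card * (6 * m.factorial) * (m + 4)
      ≤ (∑ s ∈ Finset.range (T + 1), (s + m).choose m * (Q * s + d * T + B + 3).choose 3)
          * (6 * m.factorial) * (m + 4) := by gcongr
    _ ≤ (∑ s ∈ Finset.range (T + 1), Q ^ 3 * (s + c) ^ (m + 3)) * (m + 4) := by
        rw [Finset.sum_mul]
        exact Nat.mul_le_mul_right _ (Finset.sum_le_sum fun s _ => h6 s)
    _ = Q ^ 3 * ((m + 3 + 1) * ∑ s ∈ Finset.range (T + 1), (s + c) ^ (m + 3)) := by
        rw [← Finset.mul_sum]; ring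
    _ ≤ Q ^ 3 * ((m + 3 + 1) * ∑ s ∈ Finset.range (T + 1 + c), s ^ (m + 3)) := by
        gcongr
        have : ∑ s ∈ Finset.range (T + 1), (s + c) ^ (m + 3)
            = ∑ s ∈ (Finset.range (T + 1)).image (· + c), s ^ (m + 3) := by
          rw [Finset.sum_image]
          intro a _ b _ hab
          exact Nat.add_right_cancel hab
        rw [this]
        apply Finset.sum_le_sum_of_subset
        intro x hx
        simp only [Finset.mem_image, Finset.mem_range] at hx ⊢
        omega
    _ ≤ Q ^ 3 * (T + 1 + c) ^ (m + 4) := Nat.mul_le_mul_left _ (ti_sum_pow _ _)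

/-- Support bounded by the additive weight. -/
def TiSup {τ k0 : Type*} [CommSemiring k0] (l : (τ →₀ ℕ) →+ ℕ) (W : ℕ)
    (f : MvPolynomial τ k0) : Prop := ∀ s ∈ f.support, l s ≤ W

namespace TiSup
variable {τ k0 : Type*} [CommSemiring k0] {l : (τ →₀ ℕ) →+ ℕ}

lemma mono {W W' : ℕ} {f : MvPolynomial τ k0} (h : TiSup l W f) (hW : W ≤ W') : TiSup l W' f :=
  fun s hs => (h s hs).trans hW

lemma zero (W : ℕ) : TiSup l W (0 : MvPolynomial τ k0) := by intro s hs; simp at hs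

lemma add {W : ℕ} {f g : MvPolynomial τ k0} (hf : TiSup l W f) (hg : TiSup l W g) :
    TiSup l W (f + g) := by
  classical
  intro s hs
  rcases Finset.mem_union.1 (support_add hs) with h | h
  · exact hf s h
  · exact hg s h

lemma sum {ι : Type*} {W : ℕ} (S : Finset ι) {f : ι → MvPolynomial τ k0}
    (hf : ∀ i ∈ S, TiSup l W (f i)) : TiSup l W (∑ i ∈ S, f i) := by
  classical
  induction S using Finset.induction_on with
  | empty => simpa using zero W
  | insert a S ha ih =>
    rw [Finset.sum_insert ha]
    exact (hf a (by simp)).add (ih fun i hi => hf i (by simp [hi]))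

lemma mul {W W' : ℕ} {f g : MvPolynomial τ k0} (hf : TiSup l W f) (hg : TiSup l W' g) :
    TiSup l (W + W') (f * g) := by
  classical
  intro s hs
  obtain ⟨a, ha, b, hb, rfl⟩ := Finset.mem_add.1 (support_mul f g hs)
  rw [map_add]
  exact add_le_add (hf a ha) (hg b hb)

lemma monomial (s : τ →₀ ℕ) (a : k0) : TiSup l (l s) (MvPolynomial.monomial s a) := by
  intro t ht
  have := support_monomial_subset ht
  rw [Finset.mem_singleton.1 this]

lemma C (a : k0) : TiSup l 0 (MvPolynomial.C a : MvPolynomial τ k0) := by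
  have := monomial (l := l) (0 : τ →₀ ℕ) a
  simpa using this

lemma X (i : τ) : TiSup l (l (Finsupp.single i 1)) (MvPolynomial.X i : MvPolynomial τ k0) :=
  monomial _ _

lemma pow {W : ℕ} {f : MvPolynomial τ k0} (hf : TiSup l W f) (n : ℕ) :
    TiSup l (W * n) (f ^ n) := by
  induction n with
  | zero => simpa using C (l := l) (τ := τ) (1 : k0)
  | succ n ih => rw [pow_succ, mul_add, mul_one]; exact ih.mul hf

lemma prod {ι : Type*} (S : Finset ι) {f : ι → MvPolynomial τ k0} {W : ι → ℕ}
    (hf : ∀ i ∈ S, TiSup l (W i) (f i)) : TiSup l (∑ i ∈ S, W i) (∏ i ∈ S, f i) := by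
  classical
  induction S using Finset.induction_on with
  | empty => simpa using C (l := l) (τ := τ) (1 : k0)
  | insert a S ha ih =>
    rw [Finset.prod_insert ha, Finset.sum_insert ha]
    exact (hf a (by simp)).mul (ih fun i hi => hf i (by simp [hi]))

lemma aeval_monomial {ι : Type*} {W : ℕ} {f : ι → MvPolynomial τ k0}
    (hf : ∀ i, TiSup l W (f i)) (α : ι →₀ ℕ) :
    TiSup l (W * α.degree) (aeval f (MvPolynomial.monomial α (1 : k0))) := by
  rw [MvPolynomial.aeval_monomial, map_one, one_mul, Finsupp.prod, Finsupp.degree_apply,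
    Finset.mul_sum]
  exact prod _ fun i _ => (hf i).pow _

end TiSup

/-- First weight. -/
def tiL1 (m : ℕ) : (TiVar m →₀ ℕ) →+ ℕ where
  toFun x := ∑ k, x (Sum.inr (Sum.inl k)) + x (Sum.inr (Sum.inr ()))
  map_zero' := by simp
  map_add' x y := by simp [Finset.sum_add_distrib]; ring

/-- Second weight. -/
def tiL2 (m e : ℕ) : (TiVar m →₀ ℕ) →+ ℕ where
  toFun x := ∑ i, x (Sum.inl i) + e * x (Sum.inr (Sum.inr ()))
  map_zero' := by simp
  map_add' x y := by simp [Finset.sum_add_distrib]; ring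

lemma ti_count {k0 ι : Type*} [Field k0] [Fintype ι] (m Q d B r : ℕ) (hdQ : d ≤ Q) (hQ : 0 < Q)
    (hι : Fintype.card ι = m + 4)
    (Φ : ι → MvPolynomial (TiVar m) k0) (b : Fin r → MvPolynomial (TiVar m) k0)
    (hΦ1 : ∀ j, TiSup (tiL1 m) 1 (Φ j)) (hΦ2 : ∀ j, TiSup (tiL2 m (Q - d)) Q (Φ j))
    (hb1 : ∀ j, TiSup (tiL1 m) 0 (b j)) (hb2 : ∀ j, TiSup (tiL2 m (Q - d)) B (b j))
    (hind : LinearIndependent k0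
      (fun x : Fin r × (ι →₀ ℕ) => b x.1 * aeval Φ (monomial x.2 (1 : k0)))) :
    r * Q ^ (m + 4) * (6 * m.factorial * (m + 4))
      ≤ (m + 4).factorial * Q ^ 3 * (Q + d + 2) ^ (m + 4) := by
  classical
  obtain ⟨μ, hμ⟩ : ∃ μ, μ = B + 3 + m := ⟨_, rfl⟩
  set T := Q * μ with hT
  have hμ0 : 0 < μ := by omega
  let X : Finset (TiVar m →₀ ℕ) := (tiLow (TiVar m) (T + (Q * T + B))).filter
    (fun x => tiL1 m x ≤ T ∧ tiL2 m (Q - d) x ≤ Q * T + B)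
  have hX1 : ∀ x ∈ X, tiL1 m x ≤ T := fun x hx => (Finset.mem_filter.1 hx).2.1
  have hX2 : ∀ x ∈ X, tiL2 m (Q - d) x ≤ Q * T + B := fun x hx => (Finset.mem_filter.1 hx).2.2
  have hXm : ∀ x, tiL1 m x ≤ T → tiL2 m (Q - d) x ≤ Q * T + B → x ∈ X := by
    intro x h1 h2
    refine Finset.mem_filter.2 ⟨?_, h1, h2⟩
    rw [mem_tiLow, Finsupp.degree_eq_sum, Fintype.sum_sum_type, Fintype.sum_sum_type]
    have h1' : ∑ k, x (Sum.inr (Sum.inl k)) + x (Sum.inr (Sum.inr ())) ≤ T := h1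
    have h2' : ∑ i, x (Sum.inl i) + (Q - d) * x (Sum.inr (Sum.inr ())) ≤ Q * T + B := h2
    have hu : ∑ a : Unit, x (Sum.inr (Sum.inr a)) = x (Sum.inr (Sum.inr ())) := by simp
    rw [hu]
    omega
  have hc : d * T + B + 3 ≤ Q * ((d + 1) * μ) := by
    have : μ ≤ Q * μ := Nat.le_mul_of_pos_left _ hQ
    have e : Q * ((d + 1) * μ) = d * T + Q * μ := by rw [hT]; ring
    omega
  have hmc : m ≤ (d + 1) * μ := by
    have : μ ≤ (d + 1) * μ := Nat.le_mul_of_pos_left _ (by omega)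
    omega
  have hcb := ti_card_bound m Q d T B ((d + 1) * μ) hdQ hc hmc X hX1 hX2
  -- linear algebra bound
  have hr : r * (T + (m + 4)).choose (m + 4) ≤ X.card := by
    let Y := Fin r × {α : ι →₀ ℕ // α ∈ tiLow ι T}
    have hY : Fintype.card Y = r * (T + (m + 4)).choose (m + 4) := by
      simp only [Y, Fintype.card_prod, Fintype.card_fin, Fintype.card_coe, card_tiLow, hι]
    let W := restrictSupport k0 (X : Set (TiVar m →₀ ℕ))
    have hmem : ∀ y : Y, b y.1 * aeval Φ (monomial y.2.1 (1 : k0)) ∈ W := by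
      rintro ⟨i, α, hα⟩
      rw [mem_tiLow] at hα
      rw [mem_restrictSupport_iff]
      intro x hx
      apply hXm
      · refine ((hb1 i).mul (TiSup.aeval_monomial hΦ1 α) x hx).trans ?_
        omega
      · refine ((hb2 i).mul (TiSup.aeval_monomial hΦ2 α) x hx).trans ?_
        have : Q * α.degree ≤ Q * T := Nat.mul_le_mul_left _ hα
        omega
    have hind2 : LinearIndependent k0 (fun y : Y => (⟨_, hmem y⟩ : W)) := by
      apply LinearIndependent.of_comp W.subtype
      refine hind.comp (fun y : Y => ((y.1, y.2.1) : Fin r × (ι →₀ ℕ))) ?_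
      rintro ⟨i, α, hα⟩ ⟨j, β, hβ⟩ h
      simp only [Prod.mk.injEq] at h
      obtain ⟨rfl, rfl⟩ := h
      rfl
    have bas := basisRestrictSupport k0 (X : Set (TiVar m →₀ ℕ))
    have : Module.Finite k0 W := Module.Finite.of_basis bas
    have h2 := hind2.fintype_card_le_finrank
    rw [hY, Module.finrank_eq_card_basis bas] at h2
    simpa using h2
  have h3 := ti_choose_ge T (m + 4)
  have hfin : (r * Q ^ (m + 4) * (6 * m.factorial * (m + 4))) * μ ^ (m + 4)
      ≤ ((m + 4).factorial * Q ^ 3 * (Q + d + 2) ^ (m + 4)) * μ ^ (m + 4) := by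
    calc (r * Q ^ (m + 4) * (6 * m.factorial * (m + 4))) * μ ^ (m + 4)
        = r * (Q * μ) ^ (m + 4) * (6 * m.factorial * (m + 4)) := by rw [mul_pow]; ring
      _ ≤ r * ((T + (m + 4)).choose (m + 4) * (m + 4).factorial)
            * (6 * m.factorial * (m + 4)) := by
          gcongr
          refine le_trans ?_ h3
          gcongr
          omega
      _ = (r * (T + (m + 4)).choose (m + 4)) * (6 * m.factorial) * (m + 4)
            * (m + 4).factorial := by ring
      _ ≤ X.card * (6 * m.factorial) * (m + 4) * (m + 4).factorial := by gcongr
      _ ≤ (Q ^ 3 * (T + 1 + (d + 1) * μ) ^ (m + 4)) * (m + 4).factorial := by gcongr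
      _ ≤ (Q ^ 3 * ((Q + d + 2) * μ) ^ (m + 4)) * (m + 4).factorial := by
          gcongr
          have : (Q + d + 2) * μ = T + μ + (d + 1) * μ := by rw [hT]; ring
          omega
      _ = _ := by rw [mul_pow]; ring
  exact Nat.le_of_mul_le_mul_right hfin (by positivity)

/-- base change embedding -/
noncomputable def tiEmb (m : ℕ) (k0 : Type*) [Field k0] [Algebra ℂ k0] :
    MvPolynomial (Fin 3) ℂ →ₐ[ℂ] MvPolynomial (TiVar m) k0 :=
  aeval (fun i => X (Sum.inl i))

lemma tiEmb_sup (m : ℕ) (k0 : Type*) [Field k0] [Algebra ℂ k0] (l : (TiVar m →₀ ℕ) →+ ℕ)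
    (c : ℕ) (hl : ∀ i : Fin 3, l (Finsupp.single (Sum.inl i) 1) = c)
    (f : MvPolynomial (Fin 3) ℂ) (W : ℕ) (hf : f.totalDegree ≤ W) :
    TiSup l (c * W) (tiEmb m k0 f) := by
  rw [f.as_sum, map_sum]
  refine TiSup.sum _ fun s hs => ?_
  rw [tiEmb, aeval_monomial]
  have h1 : TiSup l (0 + c * s.degree)
      (algebraMap ℂ (MvPolynomial (TiVar m) k0) (coeff s f) *
        s.prod fun i k => (X (Sum.inl i) : MvPolynomial (TiVar m) k0) ^ k) := by
    apply TiSup.mul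
    · rw [IsScalarTower.algebraMap_apply ℂ k0 (MvPolynomial (TiVar m) k0), algebraMap_eq]
      exact TiSup.C _
    · rw [Finsupp.prod, Finsupp.degree_apply, Finset.mul_sum]
      exact TiSup.prod _ fun i _ => by
        have := (TiSup.X (l := l) (k0 := k0) (Sum.inl i : TiVar m)).pow (s i)
        rwa [hl i] at this
  refine h1.mono ?_
  rw [zero_add]
  exact Nat.mul_le_mul_left _ ((le_totalDegree hs).trans hf)

lemma ti_core (m Q d r : ℕ) (hdQ : d ≤ Q) (hQ : 0 < Q)
    {ι : Type*} [Fintype ι] (hι : Fintype.card ι = m + 4)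
    (M0 : ι → MvPolynomial (Fin 3) ℂ) (M : Fin 3 → ι → MvPolynomial (Fin 3) ℂ)
    (M' : Fin m → ι → MvPolynomial (Fin 3) ℂ) (g : ι → MvPolynomial (Fin 3) ℂ)
    (hM0 : ∀ j, (M0 j).totalDegree ≤ Q) (hM : ∀ i j, (M i j).totalDegree ≤ Q)
    (hM' : ∀ i j, (M' i j).totalDegree ≤ Q) (hg : ∀ j, (g j).totalDegree ≤ d)
    {K : Type*} [Field K] [Algebra ℂ K] [Algebra (MvPolynomial (Fin 3) ℂ) K]
    [IsScalarTower ℂ (MvPolynomial (Fin 3) ℂ) K] [IsFractionRing (MvPolynomial (Fin 3) ℂ) K]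
    (u : Fin 3 → K) (t : Fin m → K) (t0 : K) (ht0 : t0 ≠ 0)
    (hid : ∀ j, algebraMap (MvPolynomial (Fin 3) ℂ) K (M0 j) + ∑ i, u i * algebraMap (MvPolynomial (Fin 3) ℂ) K (M i j)
      + ∑ k, t k * algebraMap (MvPolynomial (Fin 3) ℂ) K (M' k j) + t0 * algebraMap (MvPolynomial (Fin 3) ℂ) K (g j) = 0)
    (hli : ∀ (c0 : K) (c : Fin 3 → K) (c' : Fin m → K),
      (∀ j, c0 * algebraMap (MvPolynomial (Fin 3) ℂ) K (M0 j) + ∑ i, c i * algebraMap (MvPolynomial (Fin 3) ℂ) K (M i j)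
      + ∑ k, c' k * algebraMap (MvPolynomial (Fin 3) ℂ) K (M' k j) = 0) → c0 = 0 ∧ (∀ i, c i = 0) ∧ (∀ k, c' k = 0))
    (halg : Algebra.IsAlgebraic (IntermediateField.adjoin ℂ (Set.range u)) K)
    (b : Fin r → MvPolynomial (Fin 3) ℂ)
    (hb : LinearIndependent (IntermediateField.adjoin ℂ (Set.range u))
      (fun i => algebraMap (MvPolynomial (Fin 3) ℂ) K (b i))) :
    r * Q ^ (m + 4) * (6 * m.factorial * (m + 4))
      ≤ (m + 4).factorial * Q ^ 3 * (Q + d + 2) ^ (m + 4) := by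
  classical
  set k0 := IntermediateField.adjoin ℂ (Set.range u) with hk0
  have hu : ∀ i, u i ∈ k0 := fun i => IntermediateField.subset_adjoin _ _ ⟨i, rfl⟩
  have : CharZero K := charZero_of_injective_algebraMap (algebraMap ℂ K).injective
  let e : MvPolynomial (Fin 3) ℂ →ₐ[ℂ] MvPolynomial (TiVar m) k0 := tiEmb m k0
  let Φ : ι → MvPolynomial (TiVar m) k0 := fun j => e (M0 j) + ∑ i, C ⟨u i, hu i⟩ * e (M i j)
    + ∑ k, X (Sum.inr (Sum.inl k)) * e (M' k j) + X (Sum.inr (Sum.inr ())) * e (g j)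
  let w : TiVar m → K := Sum.elim (fun i => algebraMap (MvPolynomial (Fin 3) ℂ) K (X i)) (Sum.elim t (fun _ => t0))
  have hwe : ∀ f, aeval w (e f) = algebraMap (MvPolynomial (Fin 3) ℂ) K f := by
    intro f
    have : ((aeval w).restrictScalars ℂ).comp e
        = IsScalarTower.toAlgHom ℂ (MvPolynomial (Fin 3) ℂ) K := by
      apply MvPolynomial.algHom_ext
      intro i
      simp [e, tiEmb, w]
    exact congrArg (fun φ => φ f) this
  have hmemsup : ∀ f W, f.totalDegree ≤ W → TiSup (tiL2 m (Q - d)) W (e f) := by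
    intro f W hf
    have := tiEmb_sup m k0 (tiL2 m (Q - d)) 1 (fun i => by simp [tiL2, Finsupp.single_apply]) f W hf
    simpa using this
  have hmemsup1 : ∀ f, TiSup (tiL1 m) 0 (e f) := by
    intro f
    have := tiEmb_sup m k0 (tiL1 m) 0 (fun i => by simp [tiL1, Finsupp.single_apply]) f _ le_rfl
    simpa using this
  let B := ∑ i, (b i).totalDegree
  refine ti_count m Q d B r hdQ hQ hι Φ (fun i => e (b i)) ?_ ?_ (fun j => hmemsup1 _) ?_ ?_
  · intro j
    refine TiSup.add (TiSup.add (TiSup.add ((hmemsup1 _).mono zero_le_one) ?_) ?_) ?_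
    · exact TiSup.sum _ fun i _ => ((TiSup.C _).mul (hmemsup1 _)).mono (by norm_num)
    · refine TiSup.sum _ fun i _ => ((TiSup.X _).mul (hmemsup1 _)).mono ?_
      simp [tiL1, Finsupp.single_apply]
    · refine ((TiSup.X _).mul (hmemsup1 _)).mono ?_
      simp [tiL1, Finsupp.single_apply]
  · intro j
    refine TiSup.add (TiSup.add (TiSup.add (hmemsup _ _ (hM0 j)) ?_) ?_) ?_
    · exact TiSup.sum _ fun i _ => ((TiSup.C _).mul (hmemsup _ _ (hM i j))).mono (by omega)
    · refine TiSup.sum _ fun i _ => ((TiSup.X _).mul (hmemsup _ _ (hM' i j))).mono ?_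
      simp [tiL2, Finsupp.single_apply]
    · refine ((TiSup.X _).mul (hmemsup _ _ (hg j))).mono ?_
      simp [tiL2, Finsupp.single_apply]
      omega
  · intro j
    exact hmemsup _ _ (Finset.single_le_sum (f := fun i => (b i).totalDegree)
      (fun _ _ => Nat.zero_le _) (Finset.mem_univ j))
  · have hΦw : ∀ j, aeval w (Φ j) = 0 := by
      intro j
      rw [← hid j]
      simp only [Φ, map_add, map_sum, map_mul, hwe, aeval_X, aeval_C]
      rfl
    refine ti_indep Φ w hΦw ?_ (fun i => e (b i)) (by simpa only [hwe] using hb)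
    -- Jacobian
    let Lf : (TiVar m → K) → MvPolynomial (TiVar m) k0 → K :=
      fun v f => ∑ a, aeval w (pderiv a f) * v a
    let L : (TiVar m → K) →ₗ[K] (ι → K) :=
      { toFun := fun v j => Lf v (Φ j)
        map_add' := fun x y => by
          funext j; simp only [Lf, Pi.add_apply, mul_add, Finset.sum_add_distrib]
        map_smul' := fun c x => by
          funext j; simp only [Lf, Pi.smul_apply, smul_eq_mul, RingHom.id_apply, Finset.mul_sum]
          exact Finset.sum_congr rfl fun _ _ => by ring }
    have hinj : Function.Injective L := by
      rw [injective_iff_map_eq_zero]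
      intro v hv
      have hv' : ∀ j, Lf v (Φ j) = 0 := fun j => congrFun hv j
      obtain ⟨Ψ, hfst, hsnd⟩ := ti_exists_dual (K := K) (fun i => v (Sum.inl i))
      have hadd : ∀ f g, Lf v (f + g) = Lf v f + Lf v g := by
        intro f g; simp only [Lf, map_add, add_mul, Finset.sum_add_distrib]
      have hsum : ∀ {κ : Type} (S : Finset κ) (f : κ → MvPolynomial (TiVar m) k0),
          Lf v (∑ i ∈ S, f i) = ∑ i ∈ S, Lf v (f i) := by
        intro κ S f
        simp only [Lf, map_sum, Finset.sum_mul]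
        exact Finset.sum_comm
      have hmul : ∀ f g, Lf v (f * g) = aeval w f * Lf v g + aeval w g * Lf v f := by
        intro f g
        simp only [Lf, Derivation.leibniz, map_add, smul_eq_mul, map_mul, Finset.mul_sum]
        rw [← Finset.sum_add_distrib]
        exact Finset.sum_congr rfl fun _ _ => by ring
      have hC : ∀ c, Lf v (C c) = 0 := by intro c; simp [Lf]
      have hX : ∀ a, Lf v (X a) = v a := by
        intro a
        simp only [Lf, pderiv_X]
        rw [Finset.sum_eq_single a]
        · simp
        · intro b _ hb; simp [Pi.single_apply, hb.symm]
        · simp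
      have dmul : ∀ x y, (Ψ (x * y)).snd = x * (Ψ y).snd + y * (Ψ x).snd := by
        intro x y
        rw [map_mul, TrivSqZeroExt.snd_mul, hfst, hfst]
        simp [mul_comm]
      have dadd : ∀ x y, (Ψ (x + y)).snd = (Ψ x).snd + (Ψ y).snd := by
        intro x y; rw [map_add, TrivSqZeroExt.snd_add]
      have dsum : ∀ {κ : Type} (S : Finset κ) (f : κ → K),
          (Ψ (∑ i ∈ S, f i)).snd = ∑ i ∈ S, (Ψ (f i)).snd := by
        intro κ S f
        rw [map_sum, TrivSqZeroExt.snd_sum]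
      have dC : ∀ c : ℂ, (Ψ (algebraMap ℂ K c)).snd = 0 := by
        intro c
        rw [IsScalarTower.algebraMap_apply ℂ (MvPolynomial (Fin 3) ℂ) K, hsnd]
        simp [algebraMap_eq]
      have hLe : ∀ f, Lf v (e f) = (Ψ (algebraMap (MvPolynomial (Fin 3) ℂ) K f)).snd := by
        intro f
        induction f using MvPolynomial.induction_on with
        | C a =>
          have h1 : e (C a) = C (algebraMap ℂ k0 a) := by
            simp [e, tiEmb, IsScalarTower.algebraMap_apply ℂ k0 (MvPolynomial (TiVar m) k0)]
          rw [h1, hC, hsnd]; simp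
        | add p q hp hq => rw [map_add, hadd, map_add, dadd, hp, hq]
        | mul_X p i hp =>
          rw [map_mul, map_mul, hmul, dmul, hp, hwe, hwe]
          congr 2
          have : e (X i) = X (Sum.inl i) := by simp [e, tiEmb]
          rw [this, hX, hsnd]
          rw [Finset.sum_eq_single i]
          · simp
          · intro b _ hb; simp [pderiv_X, Pi.single_apply, hb.symm]
          · simp
      have hv2 : ∀ j, (Ψ (algebraMap (MvPolynomial (Fin 3) ℂ) K (M0 j))).snd + ∑ i, u i * (Ψ (algebraMap (MvPolynomial (Fin 3) ℂ) K (M i j))).snd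
          + ∑ k, (t k * (Ψ (algebraMap (MvPolynomial (Fin 3) ℂ) K (M' k j))).snd
              + algebraMap (MvPolynomial (Fin 3) ℂ) K (M' k j) * v (Sum.inr (Sum.inl k)))
          + (t0 * (Ψ (algebraMap (MvPolynomial (Fin 3) ℂ) K (g j))).snd
              + algebraMap (MvPolynomial (Fin 3) ℂ) K (g j) * v (Sum.inr (Sum.inr ()))) = 0 := by
        intro j
        rw [← hv' j]
        simp only [Φ, hadd, hsum, hmul, hLe, hC, hX, hwe, aeval_X, aeval_C, mul_zero, add_zero]
        rfl
      have hd : ∀ j, (Ψ (algebraMap (MvPolynomial (Fin 3) ℂ) K (M0 j))).snd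
          + ∑ i, (u i * (Ψ (algebraMap (MvPolynomial (Fin 3) ℂ) K (M i j))).snd + algebraMap (MvPolynomial (Fin 3) ℂ) K (M i j) * (Ψ (u i)).snd)
          + ∑ k, (t k * (Ψ (algebraMap (MvPolynomial (Fin 3) ℂ) K (M' k j))).snd
              + algebraMap (MvPolynomial (Fin 3) ℂ) K (M' k j) * (Ψ (t k)).snd)
          + (t0 * (Ψ (algebraMap (MvPolynomial (Fin 3) ℂ) K (g j))).snd + algebraMap (MvPolynomial (Fin 3) ℂ) K (g j) * (Ψ t0).snd) = 0 := by
        intro j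
        have := congrArg (fun x => (Ψ x).snd) (hid j)
        simp only [dadd, dsum, dmul, map_zero, TrivSqZeroExt.snd_zero] at this
        exact this
      set ω := ((Ψ t0).snd - v (Sum.inr (Sum.inr ()))) / t0 with hω
      have hω' : (Ψ t0).snd - v (Sum.inr (Sum.inr ())) = ω * t0 := by
        rw [hω]; field_simp
      have key := hli (-ω) (fun i => (Ψ (u i)).snd - ω * u i)
        (fun k => ((Ψ (t k)).snd - v (Sum.inr (Sum.inl k))) - ω * t k) (by
          intro j
          have h1 := hv2 j
          have h2 := hd j
          have h3 := hid j
          simp only [Finset.sum_add_distrib] at h1 h2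
          simp only [sub_mul, Finset.sum_sub_distrib, mul_assoc, ← Finset.mul_sum]
          have c1 : ∀ (x : Fin 3 → K), ∑ i, algebraMap (MvPolynomial (Fin 3) ℂ) K (M i j) * x i
              = ∑ i, x i * algebraMap (MvPolynomial (Fin 3) ℂ) K (M i j) := fun x =>
            Finset.sum_congr rfl fun _ _ => mul_comm _ _
          have c2 : ∀ (x : Fin m → K), ∑ i, algebraMap (MvPolynomial (Fin 3) ℂ) K (M' i j) * x i
              = ∑ i, x i * algebraMap (MvPolynomial (Fin 3) ℂ) K (M' i j) := fun x =>
            Finset.sum_congr rfl fun _ _ => mul_comm _ _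
          rw [c1, c2] at h2
          rw [c2] at h1
          linear_combination h2 - h1 - ω * h3 - algebraMap (MvPolynomial (Fin 3) ℂ) K (g j) * hω')
      obtain ⟨k1, k2, k3⟩ := key
      have hω0 : ω = 0 := by simpa using k1
      rw [hω0, zero_mul] at hω'
      simp only [hω0, zero_mul, sub_zero] at k2 k3
      have hk : ∀ a : k0, (Ψ (algebraMap k0 K a)).snd = 0 := by
        rintro ⟨a, ha⟩
        change (Ψ a).snd = 0
        rw [hk0] at ha
        induction ha using IntermediateField.adjoin_induction with
        | mem x hx => obtain ⟨i, rfl⟩ := hx; exact k2 i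
        | algebraMap x => exact dC x
        | add x y _ _ hx hy => rw [dadd, hx, hy, add_zero]
        | mul x y _ _ hx hy => rw [dmul, hx, hy, mul_zero, mul_zero, add_zero]
        | inv x _ hx =>
          by_cases hx0 : x = 0
          · simp [hx0]
          · have := dmul x x⁻¹
            rw [mul_inv_cancel₀ hx0, hx, mul_zero, add_zero, map_one, TrivSqZeroExt.snd_one] at this
            exact (mul_eq_zero.1 this.symm).resolve_left hx0
      have hall : ∀ x, (Ψ x).snd = 0 := fun x =>
        ti_alg_snd Ψ hfst hk x (Algebra.IsAlgebraic.isAlgebraic x)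
      funext a
      rcases a with i | k | a
      · have := hsnd (X i)
        rw [hall, Finset.sum_eq_single i] at this
        · simpa using this.symm
        · intro b _ hb; simp [pderiv_X, Pi.single_apply, hb.symm]
        · simp
      · have := k3 k
        rw [hall, zero_sub, neg_eq_zero] at this
        exact this
      · cases a
        rw [hall, zero_sub, neg_eq_zero] at hω'
        exact hω'
    have hsurj : Function.Surjective L := by
      refine (LinearMap.injective_iff_surjective_of_finrank_eq_finrank ?_).1 hinj
      simp [hι]; ring
    intro z
    obtain ⟨v, hv⟩ := hsurj z
    exact ⟨v, fun j => congrFun hv j⟩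

/-- generating monomials -/
def tiGenSet {σ ι : Type*} (F : ι → MvPolynomial σ ℂ) (e r0 k : ℕ) : Set (MvPolynomial σ ℂ) :=
  {g | ∃ (s : σ →₀ ℕ) (α : ι →₀ ℕ), s.degree < r0 ∧ s.degree + e * α.degree = k ∧
    g = monomial s 1 * aeval F (monomial α (1 : ℂ))}

lemma ti_hom_mul_component {σ : Type*} (e k : ℕ) (hk : e ≤ k) (F g : MvPolynomial σ ℂ)
    (hF : F.IsHomogeneous e) :
    homogeneousComponent k (g * F) = homogeneousComponent (k - e) g * F := by
  classical
  have h1 : g = ∑ i ∈ Finset.range (g.totalDegree + 1), homogeneousComponent i g :=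
    (sum_homogeneousComponent g).symm
  have h2 : ∀ i, homogeneousComponent k (homogeneousComponent i g * F)
      = if i = k - e then homogeneousComponent (k - e) g * F else 0 := by
    intro i
    have h3 : (homogeneousComponent i g * F).IsHomogeneous (i + e) :=
      (homogeneousComponent_isHomogeneous i g).mul hF
    rw [homogeneousComponent_of_mem h3]
    by_cases hi : i = k - e
    · subst hi
      rw [if_pos (by omega), if_pos rfl]
    · rw [if_neg (by omega), if_neg hi]
  conv_lhs => rw [h1, Finset.sum_mul, map_sum]
  simp only [h2]
  rw [Finset.sum_ite_eq']
  split_ifs with h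
  · rfl
  · rw [homogeneousComponent_eq_zero _ _ (by simp at h; omega), zero_mul]

lemma ti_gen {σ ι : Type*} [Fintype σ] [Fintype ι] (F : ι → MvPolynomial σ ℂ) (e : ℕ) (he : 0 < e)
    (hF : ∀ i, (F i).IsHomogeneous e)
    (hz : ∀ x : σ → ℂ, (∀ i, eval x (F i) = 0) → x = 0) :
    ∃ r0, 0 < r0 ∧ ∀ k f, f.IsHomogeneous k → f ∈ Submodule.span ℂ (tiGenSet F e r0 k) := by
  classical
  have hrad : idealOfVars σ ℂ ≤ (Ideal.span (Set.range F)).radical := by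
    rw [← vanishingIdeal_zeroLocus_eq_radical (K := ℂ), idealOfVars, Ideal.span_le]
    rintro _ ⟨i, rfl⟩
    simp only [SetLike.mem_coe, mem_vanishingIdeal_iff, mem_zeroLocus_iff]
    intro x hx
    have : x = 0 := hz x fun i => by
      have := hx (F i) (Ideal.subset_span ⟨i, rfl⟩)
      rwa [aeval_eq_eval] at this
    simp [this]
  obtain ⟨n, hn⟩ := Ideal.exists_pow_le_of_le_radical_of_fg hrad (idealOfVars_fg _ _)
  refine ⟨n + e, by omega, ?_⟩
  intro k
  induction k using Nat.strong_induction_on with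
  | _ k ih =>
  intro f hf
  by_cases hk : k < n + e
  · rw [f.as_sum]
    refine Submodule.sum_mem _ fun s hs => ?_
    have hs' : s.degree = k := by
      by_contra hne
      exact mem_support_iff.1 hs (hf.coeff_eq_zero hne)
    have : monomial s (coeff s f) = (coeff s f) • monomial s (1 : ℂ) := by
      rw [smul_monomial, smul_eq_mul, mul_one]
    rw [this]
    refine Submodule.smul_mem _ _ (Submodule.subset_span ⟨s, 0, by omega, by simp [hs'], by simp⟩)
  · have hmem : f ∈ Ideal.span (Set.range F) := by
      apply hn
      rw [mem_pow_idealOfVars_iff]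
      intro x hx
      have : x.degree = k := by
        by_contra hne
        exact mem_support_iff.1 hx (hf.coeff_eq_zero hne)
      omega
    rw [Ideal.mem_span_range_iff_exists_fun] at hmem
    obtain ⟨c, hc⟩ := hmem
    have hf2 : f = ∑ i, homogeneousComponent (k - e) (c i) * F i := by
      calc f = homogeneousComponent k f := by rw [homogeneousComponent_of_mem hf, if_pos rfl]
        _ = _ := by
          rw [← hc, map_sum]
          exact Finset.sum_congr rfl fun i _ => ti_hom_mul_component e k (by omega) _ _ (hF i)
    rw [hf2]
    refine Submodule.sum_mem _ fun i _ => ?_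
    have h1 := ih (k - e) (by omega) _ (homogeneousComponent_isHomogeneous (k - e) (c i))
    let φ : MvPolynomial σ ℂ →ₗ[ℂ] MvPolynomial σ ℂ := LinearMap.mulRight ℂ (F i)
    have h2 := Submodule.mem_map_of_mem (f := φ) h1
    rw [Submodule.map_span] at h2
    refine Submodule.span_mono ?_ h2
    rintro _ ⟨_, ⟨s, α, hs, hsα, rfl⟩, rfl⟩
    refine ⟨s, α + Finsupp.single i 1, hs, ?_, ?_⟩
    · rw [map_add, Finsupp.degree_single, mul_add, mul_one]; omega
    · have : monomial (α + Finsupp.single i 1) (1 : ℂ) = monomial α 1 * X i := by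
        rw [X, monomial_mul, mul_one]
      change monomial s 1 * aeval F (monomial α (1 : ℂ)) * F i = _
      rw [this, map_mul (aeval F), aeval_X, ← mul_assoc]

lemma ti_deg_arith (e ρ c : ℕ) (he : 0 < e)
    (h : ∀ l, (e * l + 3).choose 3 ≤ ρ * (l + c + 3).choose 3) : e ^ 3 ≤ ρ := by
  by_contra hlt
  push Not at hlt
  obtain ⟨E, hE⟩ : ∃ E, e ^ 3 = E := ⟨_, rfl⟩
  have hE0 : 0 < E := hE ▸ by positivity
  have h1 := h (7 * E * (c + 3))
  have h2 := ti_choose_ge (e * (7 * E * (c + 3))) 3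
  have h3 := ti_choose_le (7 * E * (c + 3) + c) 3
  have h4 : (e * (7 * E * (c + 3))) ^ 3 ≤ ρ * (7 * E * (c + 3) + (c + 3)) ^ 3 := by
    calc (e * (7 * E * (c + 3))) ^ 3 ≤ (e * (7 * E * (c + 3)) + 1) ^ 3 :=
          Nat.pow_le_pow_left (by omega) _
      _ ≤ _ := h2
      _ ≤ (ρ * (7 * E * (c + 3) + c + 3).choose 3) * Nat.factorial 3 :=
          Nat.mul_le_mul_right _ h1
      _ = ρ * ((7 * E * (c + 3) + c + 3).choose 3 * Nat.factorial 3) := by ring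
      _ ≤ ρ * (7 * E * (c + 3) + (c + 3)) ^ 3 := by
          refine Nat.mul_le_mul_left _ ?_
          rw [← add_assoc]
          exact h3
  have h5 : (E * (7 * E) ^ 3) * (c + 3) ^ 3 ≤ (ρ * (7 * E + 1) ^ 3) * (c + 3) ^ 3 := by
    calc _ = (e * (7 * E * (c + 3))) ^ 3 := by rw [← hE]; ring
      _ ≤ _ := h4
      _ = _ := by ring
  have h6 := Nat.le_of_mul_le_mul_right h5 (by positivity)
  rw [hE] at hlt
  have h7 : ρ * (7 * E + 1) ^ 3 ≤ (E - 1) * (7 * E + 1) ^ 3 := Nat.mul_le_mul_right _ (by omega)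
  have h8 := h6.trans h7
  obtain ⟨x, rfl⟩ : ∃ x, E = x + 1 := ⟨E - 1, by omega⟩
  rw [Nat.add_sub_cancel] at h8
  nlinarith [Nat.zero_le x, Nat.zero_le (x^2), Nat.zero_le (x^3)]

lemma ti_span_aux {K : Type*} [Field K] [Algebra ℂ K]
    (p : Fin 4 → MvPolynomial (Fin 4) ℂ) (e : ℕ) (he : 0 < e) (hp : ∀ i, (p i).IsHomogeneous e)
    (hz : ∀ x : Fin 4 → ℂ, (∀ i, eval x (p i) = 0) → x = 0)
    (ev : MvPolynomial (Fin 4) ℂ →ₐ[ℂ] K) (h0 : ev (p 0) ≠ 0)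
    (u : Fin 3 → K) (hu : ∀ i, u i * ev (p 0) = ev (p i.succ)) :
    ∃ (κ : Type) (_ : Fintype κ) (s : κ → K), ∀ l f, f.IsHomogeneous (e * l) →
      ev f / ev (p 0) ^ l ∈ Submodule.span ℂ
        {x | ∃ (a : κ) (β : Fin 3 →₀ ℕ), β.degree ≤ l ∧ x = s a * aeval u (monomial β (1 : ℂ))} := by
  obtain ⟨r0, hr0, hgen⟩ := ti_gen p e he hp hz
  refine ⟨{s // s ∈ tiLow (Fin 4) r0} × Fin r0, inferInstance,
    fun a => ev (monomial a.1.1 1) / ev (p 0) ^ (a.2 : ℕ), ?_⟩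
  intro l f hf
  let φ : MvPolynomial (Fin 4) ℂ →ₗ[ℂ] K :=
    (LinearMap.mulRight ℂ ((ev (p 0) ^ l)⁻¹)).comp ev.toLinearMap
  have h1 := Submodule.mem_map_of_mem (f := φ) (hgen (e * l) f hf)
  rw [Submodule.map_span] at h1
  have h2 : φ f = ev f / ev (p 0) ^ l := (div_eq_mul_inv _ _).symm
  rw [← h2]
  refine Submodule.span_mono ?_ h1
  rintro _ ⟨_, ⟨s, α, hs, hsα, rfl⟩, rfl⟩
  have hαl : α.degree ≤ l := by
    by_contra hlt
    push Not at hlt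
    have := Nat.mul_lt_mul_of_pos_left hlt he
    omega
  obtain ⟨t, rfl⟩ := Nat.exists_eq_add_of_le hαl
  have hst : s.degree = e * t := by rw [mul_add] at hsα; omega
  have ht : t < r0 := by
    have : t ≤ e * t := Nat.le_mul_of_pos_left _ he
    omega
  refine ⟨(⟨s, (mem_tiLow _ _).2 hs.le⟩, ⟨t, ht⟩),
    Finsupp.equivFunOnFinite.symm (fun i => α i.succ), ?_, ?_⟩
  · rw [Finsupp.degree_eq_sum] at *
    simp only [Finsupp.equivFunOnFinite_symm_apply_apply]
    rw [Finsupp.degree_eq_sum, Fin.sum_univ_succ α]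
    omega
  · change ev (monomial s 1 * aeval p (monomial α (1 : ℂ))) * (ev (p 0) ^ (α.degree + t))⁻¹ = _
    rw [map_mul, aeval_monomial, aeval_monomial, map_one (algebraMap _ _), one_mul,
      map_one (algebraMap _ _), one_mul,
      Finsupp.prod_fintype _ _ (fun _ => pow_zero _), Finsupp.prod_fintype _ _ (fun _ => pow_zero _),
      Fin.prod_univ_succ, map_mul, map_prod, map_pow]
    simp only [map_pow, ← hu, mul_pow, Finset.prod_mul_distrib,
      Finsupp.equivFunOnFinite_symm_apply_apply, Finset.prod_pow_eq_pow_sum]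
    have : α.degree = α 0 + ∑ i : Fin 3, α i.succ := by
      rw [Finsupp.degree_eq_sum, Fin.sum_univ_succ]
    rw [this, pow_add, pow_add]
    field_simp

lemma ti_alg_of_pow {k0 K : Type*} [Field k0] [Field K] [Algebra k0 K] (U : Submodule k0 K)
    [FiniteDimensional k0 U] (x : K) (hx : ∀ n : ℕ, x ^ n ∈ U) : IsAlgebraic k0 x := by
  by_contra htr
  have hinj : Function.Injective (Polynomial.aeval x : Polynomial k0 →ₐ[k0] K) :=
    transcendental_iff_injective.1 htr
  have hmem : ∀ q : Polynomial k0, Polynomial.aeval x q ∈ U := by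
    intro q
    rw [Polynomial.aeval_eq_sum_range]
    exact Submodule.sum_mem _ fun i _ => U.smul_mem _ (hx i)
  let φ : Polynomial k0 →ₗ[k0] U := (Polynomial.aeval x).toLinearMap.codRestrict U hmem
  have hφ : Function.Injective φ := by
    intro a b hab
    exact hinj (congrArg Subtype.val hab)
  have : Module.Finite k0 (Polynomial k0) := Module.Finite.of_injective φ hφ
  exact Polynomial.not_finite this

/-- dehomogenisation -/
noncomputable def tiDeh : MvPolynomial (Fin 4) ℂ →ₐ[ℂ] MvPolynomial (Fin 3) ℂ :=
  aeval (Fin.cons 1 X)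

lemma tiDeh_hom (s : Fin 3 →₀ ℕ) (k : ℕ) (hs : s.degree ≤ k) :
    ∃ f : MvPolynomial (Fin 4) ℂ, f.IsHomogeneous k ∧ tiDeh f = monomial s 1 := by
  refine ⟨monomial (Finsupp.cons (k - s.degree) s) 1, isHomogeneous_monomial _ ?_, ?_⟩
  · rw [Finsupp.degree_eq_sum, Fin.sum_univ_succ]
    simp only [Finsupp.cons_zero, Finsupp.cons_succ]
    rw [← Finsupp.degree_eq_sum]; omega
  · rw [tiDeh, aeval_monomial, Finsupp.prod_fintype _ _ (fun _ => pow_zero _), Fin.prod_univ_succ,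
      monomial_eq, Finsupp.prod_fintype _ _ (fun _ => pow_zero _)]
    simp

lemma ti_field_degree {K : Type*} [Field K] [Algebra ℂ K] [Algebra (MvPolynomial (Fin 3) ℂ) K]
    [IsScalarTower ℂ (MvPolynomial (Fin 3) ℂ) K] [IsFractionRing (MvPolynomial (Fin 3) ℂ) K]
    (p : Fin 4 → MvPolynomial (Fin 4) ℂ) (e : ℕ) (he : 0 < e) (hp : ∀ i, (p i).IsHomogeneous e)
    (hz : ∀ x : Fin 4 → ℂ, (∀ i, eval x (p i) = 0) → x = 0)
    (h0 : tiDeh (p 0) ≠ 0) (u : Fin 3 → K)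
    (hu : ∀ i, u i * algebraMap (MvPolynomial (Fin 3) ℂ) K (tiDeh (p 0))
      = algebraMap (MvPolynomial (Fin 3) ℂ) K (tiDeh (p i.succ))) :
    Algebra.IsAlgebraic (IntermediateField.adjoin ℂ (Set.range u)) K ∧
    ∃ b : Fin (e ^ 3) → MvPolynomial (Fin 3) ℂ,
      LinearIndependent (IntermediateField.adjoin ℂ (Set.range u))
        (fun i => algebraMap (MvPolynomial (Fin 3) ℂ) K (b i)) := by
  classical
  set k0 := IntermediateField.adjoin ℂ (Set.range u) with hk0
  have hmk0 : ∀ i, u i ∈ k0 := fun i => IntermediateField.subset_adjoin _ _ ⟨i, rfl⟩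
  let ev : MvPolynomial (Fin 4) ℂ →ₐ[ℂ] K :=
    (IsScalarTower.toAlgHom ℂ (MvPolynomial (Fin 3) ℂ) K).comp tiDeh
  have hev : ∀ f, ev f = algebraMap (MvPolynomial (Fin 3) ℂ) K (tiDeh f) := fun f => rfl
  have hSinj : Function.Injective (algebraMap (MvPolynomial (Fin 3) ℂ) K) :=
    IsFractionRing.injective _ _
  have hP0 : ev (p 0) ≠ 0 := by
    rw [hev, Ne, map_eq_zero_iff _ hSinj]; exact h0
  obtain ⟨κ, hκ, s, hs⟩ := ti_span_aux p e he hp hz ev hP0 u hu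
  let U : Submodule k0 K := Submodule.span k0 (Set.range s)
  have hUfin : FiniteDimensional k0 U := FiniteDimensional.span_of_finite k0 (Set.finite_range s)
  have haev : ∀ q : MvPolynomial (Fin 3) ℂ, aeval u q ∈ k0 := by
    intro q
    have : aeval u q = algebraMap k0 K (aeval (fun i => (⟨u i, hmk0 i⟩ : k0)) q) := by
      rw [← aeval_algebraMap_apply]
      rfl
    rw [this]
    exact Subtype.property _
  -- membership in U
  have hU : ∀ l f, f.IsHomogeneous (e * l) → ev f / ev (p 0) ^ l ∈ U := by
    intro l f hf
    have h1 := hs l f hf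
    have : Submodule.span ℂ {x | ∃ (a : κ) (β : Fin 3 →₀ ℕ), β.degree ≤ l ∧
        x = s a * aeval u (monomial β (1 : ℂ))} ≤ U.restrictScalars ℂ := by
      rw [Submodule.span_le]
      rintro _ ⟨a, β, _, rfl⟩
      have : s a * aeval u (monomial β (1 : ℂ))
          = (⟨aeval u (monomial β (1 : ℂ)), haev _⟩ : k0) • s a := by
        rw [mul_comm]; rfl
      rw [this]
      exact U.smul_mem _ (Submodule.subset_span ⟨a, rfl⟩)
    exact this h1
  have halgl : ∀ f, f.IsHomogeneous e → IsAlgebraic k0 (ev f / ev (p 0)) := by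
    intro f hf
    refine ti_alg_of_pow U _ fun n => ?_
    rw [div_pow, ← map_pow]
    exact hU n _ (hf.pow n)
  have halg : Algebra.IsAlgebraic k0 K := by
    have hP : IsAlgebraic k0 (ev (p 0)) := by
      have := halgl (X 0 ^ e) (by simpa using (isHomogeneous_X ℂ (0 : Fin 4)).pow e)
      have h2 : ev (X 0 ^ e) = 1 := by rw [hev]; simp [tiDeh]
      rw [h2, one_div] at this
      simpa using this.inv
    have hy : ∀ i, IsAlgebraic k0 (algebraMap (MvPolynomial (Fin 3) ℂ) K (X i)) := by
      intro i
      have := halgl (X 0 ^ (e - 1) * X i.succ) (by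
        have := ((isHomogeneous_X ℂ (0 : Fin 4)).pow (e - 1)).mul (isHomogeneous_X ℂ i.succ)
        have h2 : 1 * (e - 1) + 1 = e := by omega
        rwa [h2] at this)
      have h2 : ev (X 0 ^ (e - 1) * X i.succ) = algebraMap (MvPolynomial (Fin 3) ℂ) K (X i) := by
        rw [hev]; simp [tiDeh]
      rw [h2] at this
      have h3 := this.mul hP
      rwa [div_mul_cancel₀ _ hP0] at h3
    have hall : ∀ f, IsAlgebraic k0 (algebraMap (MvPolynomial (Fin 3) ℂ) K f) := by
      intro f
      induction f using MvPolynomial.induction_on with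
      | C a =>
        have : algebraMap (MvPolynomial (Fin 3) ℂ) K (C a)
            = algebraMap k0 K (algebraMap ℂ k0 a) := by
          rw [← IsScalarTower.algebraMap_apply, ← algebraMap_eq, ← IsScalarTower.algebraMap_apply]
        rw [this]; exact isAlgebraic_algebraMap _
      | add p q hp hq => rw [map_add]; exact hp.add hq
      | mul_X p i hp => rw [map_mul]; exact hp.mul (hy i)
    refine ⟨fun x => ?_⟩
    obtain ⟨a, b, hb, rfl⟩ := IsFractionRing.div_surjective (A := MvPolynomial (Fin 3) ℂ) x
    rw [div_eq_mul_inv]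
    exact (hall a).mul (hall b).inv
  refine ⟨halg, ?_⟩
  -- basis
  let ρ := Module.finrank k0 U
  let B : Module.Basis (Fin ρ) k0 U := Module.finBasis k0 U
  -- coefficients with common denominators
  have hcoef : ∀ x : k0, ∃ a r : MvPolynomial (Fin 3) ℂ, aeval u a ≠ 0 ∧
      (x : K) = aeval u r / aeval u a := by
    rintro ⟨x, hx⟩
    rw [hk0, IntermediateField.mem_adjoin_range_iff] at hx
    obtain ⟨r, a, hra⟩ := hx
    by_cases ha : aeval u a = 0
    · refine ⟨1, 0, by simp, ?_⟩
      simp [hra, ha]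
    · exact ⟨a, r, ha, hra⟩
  let cf : κ × Fin ρ → k0 := fun x => B.repr ⟨s x.1, Submodule.subset_span ⟨x.1, rfl⟩⟩ x.2
  choose da dr hda hdr using fun x => hcoef (cf x)
  let A : MvPolynomial (Fin 3) ℂ := ∏ x, da x
  have hA : aeval u A ≠ 0 := by
    simp only [A, map_prod]
    exact Finset.prod_ne_zero_iff.2 fun x _ => hda x
  let R : κ × Fin ρ → MvPolynomial (Fin 3) ℂ := fun x => dr x * ∏ y ∈ Finset.univ.erase x, da y
  have hR : ∀ x, (cf x : K) * aeval u A = aeval u (R x) := by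
    intro x
    have : A = da x * ∏ y ∈ Finset.univ.erase x, da y :=
      (Finset.mul_prod_erase _ _ (Finset.mem_univ x)).symm
    rw [hdr x, this, map_mul, map_mul]
    have := hda x
    field_simp
  let c := ∑ x, (R x).totalDegree
  let W : ℕ → Submodule ℂ (MvPolynomial (Fin 3) ℂ) := fun l =>
    restrictSupport ℂ (tiLow (Fin 3) l : Set (Fin 3 →₀ ℕ))
  have hWfin : ∀ l, Module.Finite ℂ (W l) := fun l =>
    Module.Finite.of_basis (basisRestrictSupport ℂ (tiLow (Fin 3) l : Set (Fin 3 →₀ ℕ)))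
  have hWrank : ∀ l, Module.finrank ℂ (W l) = (l + 3).choose 3 := by
    intro l
    rw [Module.finrank_eq_card_basis
      (basisRestrictSupport ℂ (tiLow (Fin 3) l : Set (Fin 3 →₀ ℕ)))]
    simp [card_tiLow]
  have hWmem : ∀ l f, f ∈ W l ↔ f.totalDegree ≤ l := by
    intro l f
    rw [mem_restrictSupport_iff, totalDegree, Finset.sup_le_iff]
    simp only [Set.subset_def, Finset.mem_coe, mem_tiLow]
    rfl
  have hbound : ∀ l, (e * l + 3).choose 3 ≤ ρ * (l + c + 3).choose 3 := by
    intro l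
    let θ : (Fin ρ → W (l + c)) →ₗ[ℂ] K :=
      { toFun := fun q => ∑ i, aeval u (q i : MvPolynomial (Fin 3) ℂ) * (B i : K)
        map_add' := fun x y => by simp [add_mul, Finset.sum_add_distrib]
        map_smul' := fun a x => by simp [Finset.smul_sum] }
    let η : W (e * l) →ₗ[ℂ] K :=
      ((LinearMap.mulRight ℂ (aeval u A / ev (p 0) ^ l)).comp
        (IsScalarTower.toAlgHom ℂ (MvPolynomial (Fin 3) ℂ) K).toLinearMap).comp (W (e * l)).subtype
    have hηinj : Function.Injective η := by
      intro x y hxy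
      have h1 : algebraMap (MvPolynomial (Fin 3) ℂ) K x * (aeval u A / ev (p 0) ^ l)
          = algebraMap (MvPolynomial (Fin 3) ℂ) K y * (aeval u A / ev (p 0) ^ l) := hxy
      have h2 := mul_right_cancel₀ (div_ne_zero hA (pow_ne_zero _ hP0)) h1
      exact Subtype.ext (hSinj h2)
    have hspan : ∀ x ∈ Submodule.span ℂ {x | ∃ (a : κ) (β : Fin 3 →₀ ℕ), β.degree ≤ l ∧
        x = s a * aeval u (monomial β (1 : ℂ))}, x * aeval u A ∈ LinearMap.range θ := by
      intro x hx
      have : Submodule.span ℂ {x | ∃ (a : κ) (β : Fin 3 →₀ ℕ), β.degree ≤ l ∧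
        x = s a * aeval u (monomial β (1 : ℂ))} ≤
          (LinearMap.range θ).comap (LinearMap.mulRight ℂ (aeval u A)) := by
        rw [Submodule.span_le]
        rintro _ ⟨a, β, hβ, rfl⟩
        refine ⟨fun i => ⟨monomial β 1 * R (a, i), ?_⟩, ?_⟩
        · rw [hWmem]
          refine (totalDegree_mul _ _).trans (add_le_add ?_ ?_)
          · refine (totalDegree_monomial_le _ _).trans ?_
            exact hβ
          · exact Finset.single_le_sum (f := fun x => (R x).totalDegree)
              (fun _ _ => Nat.zero_le _) (Finset.mem_univ (a, i))
        · have hsa : s a = ∑ i, (cf (a, i) : K) * (B i : K) := by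
            have := B.sum_repr ⟨s a, Submodule.subset_span ⟨a, rfl⟩⟩
            have h2 := congrArg (Subtype.val) this
            rw [AddSubmonoidClass.coe_finset_sum] at h2
            exact h2.symm
          change ∑ i, aeval u (monomial β 1 * R (a, i)) * (B i : K)
            = s a * aeval u (monomial β (1 : ℂ)) * aeval u A
          rw [hsa, Finset.sum_mul, Finset.sum_mul]
          refine Finset.sum_congr rfl fun i _ => ?_
          rw [map_mul, ← hR]
          ring
      exact this hx
    have hrange : LinearMap.range η ≤ LinearMap.range θ := by
      rintro _ ⟨⟨g, hg⟩, rfl⟩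
      change algebraMap (MvPolynomial (Fin 3) ℂ) K g * (aeval u A / ev (p 0) ^ l) ∈ _
      have hg' := hg
      simp only [W, restrictSupport_eq_span] at hg'
      have : Submodule.span ℂ ((fun x => monomial x (1 : ℂ)) ''
          (tiLow (Fin 3) (e * l) : Set (Fin 3 →₀ ℕ))) ≤
          (LinearMap.range θ).comap ((LinearMap.mulRight ℂ (aeval u A / ev (p 0) ^ l)).comp
        (IsScalarTower.toAlgHom ℂ (MvPolynomial (Fin 3) ℂ) K).toLinearMap) := by
        rw [Submodule.span_le]
        rintro _ ⟨t, ht, rfl⟩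
        change algebraMap (MvPolynomial (Fin 3) ℂ) K (monomial t 1) * (aeval u A / ev (p 0) ^ l)
          ∈ LinearMap.range θ
        obtain ⟨f, hf, hft⟩ := tiDeh_hom t (e * l) ((mem_tiLow _ _).1 ht)
        have := hspan _ (hs l f hf)
        rw [hev f, hft] at this
        convert this using 1
        ring
      exact this hg'
    calc (e * l + 3).choose 3 = Module.finrank ℂ (W (e * l)) := (hWrank _).symm
      _ = Module.finrank ℂ (LinearMap.range η) := (LinearMap.finrank_range_of_inj hηinj).symm
      _ ≤ Module.finrank ℂ (LinearMap.range θ) := Submodule.finrank_mono hrange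
      _ ≤ Module.finrank ℂ (Fin ρ → W (l + c)) := LinearMap.finrank_range_le θ
      _ = _ := by rw [Module.finrank_pi_fintype]; simp [hWrank]
  have hρ : e ^ 3 ≤ ρ := ti_deg_arith e ρ c he hbound
  obtain ⟨D, hD⟩ := IsLocalization.exist_integer_multiples_of_finite
    (nonZeroDivisors (MvPolynomial (Fin 3) ℂ)) (fun i : Fin ρ => (B i : K))
  choose b hb using hD
  refine ⟨fun i => b (Fin.castLE hρ i), ?_⟩
  have hD0 : algebraMap (MvPolynomial (Fin 3) ℂ) K D ≠ 0 := by
    rw [Ne, map_eq_zero_iff _ hSinj]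
    exact nonZeroDivisors.ne_zero D.2
  have h1 : LinearIndependent k0 (fun i => (B i : K)) :=
    B.linearIndependent.map' U.subtype (by simp)
  have h2 : LinearIndependent k0 (fun i => algebraMap (MvPolynomial (Fin 3) ℂ) K (b i)) := by
    have := h1.map' (LinearMap.mulLeft k0 (algebraMap (MvPolynomial (Fin 3) ℂ) K D)) (by
      rw [LinearMap.ker_eq_bot]
      exact mul_right_injective₀ hD0)
    have e1 : (fun i => algebraMap (MvPolynomial (Fin 3) ℂ) K (b i))
        = (LinearMap.mulLeft k0 (algebraMap (MvPolynomial (Fin 3) ℂ) K D)) ∘ (fun i => (B i : K)) := by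
      funext i
      rw [hb i, Algebra.smul_def]
      rfl
    rw [e1]
    exact this
  exact h2.comp _ (Fin.castLE_injective hρ)

lemma ti_integral {σ ι : Type*} [Fintype σ] [Fintype ι] (F : ι → MvPolynomial σ ℂ) (e : ℕ)
    (he : 0 < e) (hF : ∀ i, (F i).IsHomogeneous e)
    (hz : ∀ x : σ → ℂ, (∀ i, eval x (F i) = 0) → x = 0) :
    (aeval F : MvPolynomial ι ℂ →ₐ[ℂ] MvPolynomial σ ℂ).toRingHom.IsIntegral := by
  classical
  obtain ⟨r0, hr0, hgen⟩ := ti_gen F e he hF hz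
  apply RingHom.Finite.to_isIntegral
  let φ := (aeval F : MvPolynomial ι ℂ →ₐ[ℂ] MvPolynomial σ ℂ).toRingHom
  letI : Algebra (MvPolynomial ι ℂ) (MvPolynomial σ ℂ) := φ.toAlgebra
  have hsm : ∀ (a : MvPolynomial ι ℂ) (b : MvPolynomial σ ℂ), a • b = aeval F a * b :=
    fun a b => rfl
  change Module.Finite (MvPolynomial ι ℂ) (MvPolynomial σ ℂ)
  refine ⟨⟨(tiLow σ r0).image (fun s => monomial s (1 : ℂ)), ?_⟩⟩
  rw [eq_top_iff]
  intro f _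
  rw [← sum_homogeneousComponent f]
  refine Submodule.sum_mem _ fun k _ => ?_
  have h1 := hgen k _ (homogeneousComponent_isHomogeneous k f)
  generalize homogeneousComponent k f = z at h1 ⊢
  induction h1 using Submodule.span_induction with
  | mem x hx =>
    obtain ⟨s, α, hs, _, rfl⟩ := hx
    rw [mul_comm, ← hsm]
    refine Submodule.smul_mem _ _ (Submodule.subset_span ?_)
    simp only [Finset.coe_image, Set.mem_image, Finset.mem_coe, mem_tiLow]
    exact ⟨s, hs.le, rfl⟩
  | zero => exact Submodule.zero_mem _
  | add x y _ _ hx hy => exact Submodule.add_mem _ hx hy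
  | smul a x _ hx =>
    have : a • x = (C a : MvPolynomial ι ℂ) • x := by
      rw [hsm, aeval_C, Algebra.smul_def]
    rw [this]
    exact Submodule.smul_mem _ _ hx

lemma ti_krull_integral {A B : Type*} [CommRing A] [CommRing B] (f : A →+* B)
    (hf : f.IsIntegral) : ringKrullDim B ≤ ringKrullDim A := by
  letI := f.toAlgebra
  have : Algebra.IsIntegral A B := ⟨hf⟩
  refine Order.krullDim_le_of_strictMono (PrimeSpectrum.comap f) ?_
  intro P Q hPQ
  have hlt : P.asIdeal < Q.asIdeal := hPQ
  have := Ideal.comap_lt_comap_of_integral_mem_sdiff (R := A) (I := P.asIdeal) (J := Q.asIdeal)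
  obtain ⟨x, hxQ, hxP⟩ := Set.exists_of_ssubset hlt
  exact this hlt.le ⟨hxQ, hxP⟩ (Algebra.IsIntegral.isIntegral x)

lemma ti_krull_map {A B : Type*} [CommRing A] [CommRing B] (f : A →+* B)
    (hf : f.IsIntegral) (I : Ideal A) : ringKrullDim (B ⧸ I.map f) ≤ ringKrullDim (A ⧸ I) := by
  apply ti_krull_integral (Ideal.quotientMap (I.map f) f Ideal.le_comap_map)
  intro x
  obtain ⟨x, rfl⟩ := Ideal.Quotient.mk_surjective x
  obtain ⟨p, hp, hpx⟩ := hf x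
  refine ⟨p.map (Ideal.Quotient.mk I), hp.map _, ?_⟩
  have hc : (Ideal.quotientMap (I.map f) f Ideal.le_comap_map).comp (Ideal.Quotient.mk I)
      = (Ideal.Quotient.mk (I.map f)).comp f := by
    ext a; simp
  rw [Polynomial.eval₂_map, hc, ← Polynomial.hom_eval₂, hpx, map_zero]

lemma ti_det_ne (N : ℕ) (F : Fin N → MvPolynomial (Fin N) ℂ) (e : ℕ)
    (he : 0 < e) (hF : ∀ i, (F i).IsHomogeneous e)
    (hz : ∀ x : Fin N → ℂ, (∀ i, eval x (F i) = 0) → x = 0) :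
    (Matrix.of fun i j => pderiv j (F i)).det ≠ 0 := by
  intro hdet
  obtain ⟨v, hv0, hv⟩ := Matrix.exists_mulVec_eq_zero_iff.2 hdet
  let K := FractionRing (MvPolynomial (Fin N) ℂ)
  let am := algebraMap (MvPolynomial (Fin N) ℂ) K
  have hinj : Function.Injective am := IsFractionRing.injective _ _
  obtain ⟨Ψ, hfst, hsnd⟩ := ti_exists_dual (K := K) (fun i => am (v i))
  let k0 := IntermediateField.adjoin ℂ (Set.range fun i => am (F i))
  have hmem : ∀ i, am (F i) ∈ k0 := fun i => IntermediateField.subset_adjoin _ _ ⟨i, rfl⟩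
  have dmul : ∀ x y, (Ψ (x * y)).snd = x * (Ψ y).snd + y * (Ψ x).snd := by
    intro x y
    rw [map_mul, TrivSqZeroExt.snd_mul, hfst, hfst]
    simp [mul_comm]
  have dadd : ∀ x y, (Ψ (x + y)).snd = (Ψ x).snd + (Ψ y).snd := by
    intro x y; rw [map_add, TrivSqZeroExt.snd_add]
  have dC : ∀ c : ℂ, (Ψ (algebraMap ℂ K c)).snd = 0 := by
    intro c
    rw [IsScalarTower.algebraMap_apply ℂ (MvPolynomial (Fin N) ℂ) K, hsnd]
    simp [algebraMap_eq]
  have hk : ∀ a : k0, (Ψ (algebraMap k0 K a)).snd = 0 := by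
    rintro ⟨a, ha⟩
    change (Ψ a).snd = 0
    induction ha using IntermediateField.adjoin_induction with
    | mem x hx =>
      obtain ⟨i, rfl⟩ := hx
      change (Ψ (am (F i))).snd = 0
      rw [hsnd]
      have := congrArg am (congrFun hv i)
      simpa [Matrix.mulVec, dotProduct] using this
    | algebraMap x => exact dC x
    | add x y _ _ hx hy => rw [dadd, hx, hy, add_zero]
    | mul x y _ _ hx hy => rw [dmul, hx, hy, mul_zero, mul_zero, add_zero]
    | inv x _ hx =>
      by_cases hx0 : x = 0
      · simp [hx0]
      · have := dmul x x⁻¹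
        rw [mul_inv_cancel₀ hx0, hx, mul_zero, add_zero, map_one, TrivSqZeroExt.snd_one] at this
        exact (mul_eq_zero.1 this.symm).resolve_left hx0
  have : CharZero k0 := charZero_of_injective_algebraMap (algebraMap ℂ k0).injective
  let φ : MvPolynomial (Fin N) ℂ →ₐ[ℂ] k0 := aeval (fun i => (⟨am (F i), hmem i⟩ : k0))
  have hφ : (algebraMap k0 K).comp φ.toRingHom
      = am.comp (aeval F : MvPolynomial (Fin N) ℂ →ₐ[ℂ] MvPolynomial (Fin N) ℂ).toRingHom := by
    apply MvPolynomial.ringHom_ext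
    · intro r
      simp [φ, am]
      rw [← algebraMap_eq, ← IsScalarTower.algebraMap_apply]
    · intro i
      simp [φ]
  apply hv0
  funext i
  obtain ⟨q, hq, hq0⟩ := ti_integral F e he hF hz (X i)
  have hint : IsAlgebraic k0 (am (X i)) := by
    apply IsIntegral.isAlgebraic
    refine ⟨q.map φ.toRingHom, hq.map _, ?_⟩
    rw [Polynomial.eval₂_map, hφ, ← Polynomial.hom_eval₂, hq0, map_zero]
  have h1 := ti_alg_snd Ψ hfst hk _ hint
  rw [hsnd, Finset.sum_eq_single i] at h1
  · apply hinj
    simpa using h1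
  · intro b _ hb; simp [pderiv_X, hb.symm]
  · simp

lemma ti_krull_mono {R : Type*} [CommRing R] {I J : Ideal R} (hIJ : I ≤ J) :
    ringKrullDim (R ⧸ J) ≤ ringKrullDim (R ⧸ I) :=
  ringKrullDim_le_of_surjective (Ideal.Quotient.factor hIJ) (Ideal.Quotient.factor_surjective hIJ)

lemma ti_ser_a {α : Type*} [PartialOrder α] (S T : Set α) (p : LTSeries S)
    (h : ∀ i, (p i).1 ∈ T) : (p.length : WithBot ℕ∞) ≤ Order.krullDim T := by
  let s : LTSeries T := ⟨p.length, fun i => ⟨(p i).1, h i⟩, fun i => p.step i⟩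
  exact Order.LTSeries.length_le_krullDim s

lemma ti_ser_b {α : Type*} [PartialOrder α] (S T : Set α) (p : LTSeries S)
    (h : ∀ i, (p i).1 ∈ T) (a : α) (ha : a ∈ T) (hlt : a < p.head.1) :
    ((p.length + 1 : ℕ) : WithBot ℕ∞) ≤ Order.krullDim T := by
  let s : LTSeries T := ⟨p.length, fun i => ⟨(p i).1, h i⟩, fun i => p.step i⟩
  have hs : (⟨a, ha⟩ : T) < s.head := hlt
  have := Order.LTSeries.length_le_krullDim (s.cons ⟨a, ha⟩ hs)
  rw [RelSeries.cons_length] at this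
  exact this

lemma ti_slice_one {R : Type*} [CommRing R] [Algebra ℂ R] [IsNoetherianRing R]
    (V : Submodule ℂ R) (I : Ideal R) (e k : ℕ)
    (h1 : ringKrullDim (R ⧸ (I ⊔ Ideal.span (V : Set R))) ≤ (e : ℕ))
    (h2 : ringKrullDim (R ⧸ I) ≤ ((e + k + 1 : ℕ) : WithBot ℕ∞)) :
    ∃ w ∈ V, ringKrullDim (R ⧸ (I ⊔ Ideal.span {w})) ≤ ((e + k : ℕ) : WithBot ℕ∞) := by
  classical
  have hfin := Ideal.finite_minimalPrimes_of_isNoetherianRing R I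
  let T := {P : Ideal R // P ∈ I.minimalPrimes ∧ ¬ (V : Set R) ⊆ P}
  have : Finite T := (hfin.subset (fun P hP => hP.1) : {P | P ∈ I.minimalPrimes ∧ ¬ (V : Set R) ⊆ P}.Finite)
  obtain ⟨w, hw⟩ := Submodule.exists_forall_notMem_of_forall_ne_top
    (fun P : T => (P.1.restrictScalars ℂ).comap V.subtype) (by
      rintro ⟨P, hP, hV⟩ htop
      apply hV
      intro x hx
      have : (⟨x, hx⟩ : V) ∈ (P.restrictScalars ℂ).comap V.subtype := by
        rw [htop]; trivial
      simpa using this)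
  refine ⟨w, w.2, ?_⟩
  rw [ringKrullDim_quotient] at h1 h2 ⊢
  refine iSup_le fun p => ?_
  have hmem : ∀ i, I ≤ (p i).1.asIdeal ∧ (w : R) ∈ (p i).1.asIdeal := by
    intro i
    have := (p i).2
    rw [PrimeSpectrum.mem_zeroLocus, SetLike.coe_subset_coe, sup_le_iff,
      Ideal.span_singleton_le_iff_mem] at this
    exact this
  haveI := p.head.1.isPrime
  obtain ⟨P, hP, hPle⟩ := Ideal.exists_minimalPrimes_le (J := p.head.1.asIdeal) (I := I) (hmem 0).1
  by_cases hV : (V : Set R) ⊆ P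
  · have := (ti_ser_a _ _ p (fun i => by
        rw [PrimeSpectrum.mem_zeroLocus, SetLike.coe_subset_coe, sup_le_iff, Ideal.span_le]
        refine ⟨(hmem i).1, fun x hx => ?_⟩
        have h3 : (p.head).1 ≤ (p i).1 := p.monotone (Fin.zero_le i)
        exact h3 (hPle (hV hx)))).trans h1
    refine this.trans ?_
    exact Nat.cast_le.2 (Nat.le_add_right e k)
  · have hlt : (⟨P, hP.1.1⟩ : PrimeSpectrum R) < p.head.1 := by
      rw [← PrimeSpectrum.asIdeal_lt_asIdeal]
      refine lt_of_le_of_ne hPle ?_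
      intro heq
      apply hw ⟨P, hP, hV⟩
      have h0 : (w : R) ∈ p.head.1.asIdeal := (hmem 0).2
      rw [Submodule.mem_comap, Submodule.restrictScalars_mem]
      rw [← heq] at h0
      exact h0
    have := (ti_ser_b _ _ p (fun i => (PrimeSpectrum.mem_zeroLocus _ _).2
      (SetLike.coe_subset_coe.2 (hmem i).1)) _
      ((PrimeSpectrum.mem_zeroLocus _ _).2 (SetLike.coe_subset_coe.2 hP.1.2)) hlt).trans h2
    have h5 : p.length + 1 ≤ e + k + 1 := Nat.cast_le.1 this
    have : p.length ≤ e + k := by omega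
    exact Nat.cast_le.2 this

lemma ti_slice {R : Type*} [CommRing R] [Algebra ℂ R] [IsNoetherianRing R]
    (V : Submodule ℂ R) (e k : ℕ) : ∀ (I : Ideal R)
    (_ : ringKrullDim (R ⧸ (I ⊔ Ideal.span (V : Set R))) ≤ (e : ℕ))
    (_ : ringKrullDim (R ⧸ I) ≤ ((e + k : ℕ) : WithBot ℕ∞)),
    ∃ w : Fin k → R, (∀ i, w i ∈ V) ∧
      ringKrullDim (R ⧸ (I ⊔ Ideal.span (Set.range w))) ≤ (e : ℕ) := by
  induction k with
  | zero =>
    intro I h1 h2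
    exact ⟨Fin.elim0, fun i => i.elim0, (ti_krull_mono le_sup_left).trans h2⟩
  | succ k ih =>
    intro I h1 h2
    obtain ⟨w0, hw0, h3⟩ := ti_slice_one V I e k h1 h2
    obtain ⟨w, hw, h4⟩ := ih (I ⊔ Ideal.span {w0})
      ((ti_krull_mono (sup_le_sup_right le_sup_left _)).trans h1) h3
    refine ⟨Fin.cons w0 w, ?_, ?_⟩
    · intro i
      refine Fin.cases ?_ ?_ i
      · simpa using hw0
      · intro i; simpa using hw i
    · have : I ⊔ Ideal.span (Set.range (Fin.cons w0 w : Fin (k+1) → R))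
        = I ⊔ Ideal.span {w0} ⊔ Ideal.span (Set.range w) := by
        rw [Fin.range_cons, Set.insert_eq, Ideal.span_union, sup_assoc]
      rw [this]; exact h4

/-- zero-dimensional homogeneous ideals have no nonzero zeros -/
lemma ti_no_zero {N : ℕ} (I : Ideal (MvPolynomial (Fin N) ℂ)) (x : Fin N → ℂ)
    (hI : ∀ f ∈ I, ∀ s : ℂ, eval (s • x) f = 0)
    (hd : ringKrullDim (MvPolynomial (Fin N) ℂ ⧸ I) ≤ ((0 : ℕ) : WithBot ℕ∞)) : x = 0 := by
  by_contra hx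
  obtain ⟨i, hi⟩ : ∃ i, x i ≠ 0 := by
    by_contra h; push Not at h; exact hx (funext h)
  let φ : MvPolynomial (Fin N) ℂ →+* Polynomial ℂ :=
    (aeval (fun i => Polynomial.C (x i) * Polynomial.X) : MvPolynomial (Fin N) ℂ →ₐ[ℂ] Polynomial ℂ).toRingHom
  have hφ : ∀ f s, (φ f).eval s = eval (s • x) f := by
    intro f s
    have : ((Polynomial.evalRingHom s).comp φ) = eval (s • x) := by
      apply MvPolynomial.ringHom_ext
      · intro r; simp [φ]
      · intro i; simp [φ]; ring
    exact RingHom.congr_fun this f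
  have hs : Function.Surjective φ := by
    intro p
    refine ⟨Polynomial.aeval (C (x i)⁻¹ * X i : MvPolynomial (Fin N) ℂ) p, ?_⟩
    have : ((φ : MvPolynomial (Fin N) ℂ →+* Polynomial ℂ).comp
      (Polynomial.aeval (C (x i)⁻¹ * X i : MvPolynomial (Fin N) ℂ) :
        Polynomial ℂ →ₐ[ℂ] _).toRingHom) = RingHom.id _ := by
      apply Polynomial.ringHom_ext
      · intro a; simp [φ]
      · simp [φ, ← mul_assoc, ← Polynomial.C_mul, hi]
    exact RingHom.congr_fun this p
  have h1 : ringKrullDim (Polynomial ℂ) ≤ ringKrullDim (MvPolynomial (Fin N) ℂ ⧸ I) := by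
    refine ringKrullDim_le_of_surjective (Ideal.Quotient.lift I φ ?_)
      (Ideal.Quotient.lift_surjective_of_surjective _ _ hs)
    intro f hf
    apply Polynomial.funext
    intro s
    rw [hφ, hI f hf, Polynomial.eval_zero]
  have h2 := h1.trans hd
  rw [Polynomial.ringKrullDim_of_isNoetherianRing, ringKrullDim_eq_zero_of_field] at h2
  norm_num at h2

lemma ti_eval_aeval {σ ι : Type*} (G : ι → MvPolynomial σ ℂ) (x : σ → ℂ) (f : MvPolynomial ι ℂ) :
    eval x (aeval G f) = eval (fun j => eval x (G j)) f := by
  have : (eval x).comp (aeval G : MvPolynomial ι ℂ →ₐ[ℂ] MvPolynomial σ ℂ).toRingHom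
      = eval (fun j => eval x (G j)) := by
    apply MvPolynomial.ringHom_ext
    · intro r; simp
    · intro i; simp
  exact RingHom.congr_fun this f

lemma ti_aeval_aeval {σ ι κ : Type*} (G : ι → MvPolynomial σ ℂ) (F : κ → MvPolynomial ι ℂ)
    (f : MvPolynomial κ ℂ) :
    aeval G (aeval F f) = aeval (fun j => aeval G (F j)) f := by
  have : (aeval G : MvPolynomial ι ℂ →ₐ[ℂ] MvPolynomial σ ℂ).comp (aeval F)
      = aeval (fun j => aeval G (F j)) := by
    apply MvPolynomial.algHom_ext
    intro i; simp
  exact AlgHom.congr_fun this f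

lemma ti_iter {N q : ℕ} {F : Fin N → MvPolynomial (Fin N) ℂ} (hF : IsEndo N q F)
    {h : MvPolynomial (Fin N) ℂ} {lam : ℂ} (hl : lam ≠ 0) (hi : aeval F h = C lam * h ^ q) (k : ℕ) :
    ∃ G : Fin N → MvPolynomial (Fin N) ℂ, IsEndo N (q ^ k) G ∧ ∃ mu : ℂ, mu ≠ 0 ∧
      aeval G h = C mu * h ^ (q ^ k) := by
  induction k with
  | zero =>
    refine ⟨X, ⟨fun i => by simpa using isHomogeneous_X ℂ i, fun x hx => ?_⟩, 1, one_ne_zero, ?_⟩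
    · funext i; simpa using hx i
    · simp
  | succ k ih =>
    obtain ⟨G, ⟨hG1, hG2⟩, mu, hmu, hG⟩ := ih
    refine ⟨fun i => aeval G (F i), ⟨fun i => ?_, fun x hx => ?_⟩, lam * mu ^ q,
      mul_ne_zero hl (pow_ne_zero _ hmu), ?_⟩
    · have := (hF.1 i).aeval G hG1
      rwa [pow_succ]
    · apply hG2
      intro i
      have := hF.2 (fun j => eval x (G j)) (fun i => by rw [← ti_eval_aeval]; exact hx i)
      exact congrFun this i
    · rw [← ti_aeval_aeval, hi, map_mul, map_pow, hG, aeval_C, algebraMap_eq, mul_pow, ← pow_mul,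
        ← pow_succ, map_mul, map_pow]
      ring

lemma ti_chain {σ ι : Type*} [Fintype ι] (F : ι → MvPolynomial σ ℂ)
    (h : MvPolynomial ι ℂ) (j : σ) :
    pderiv j (aeval F h) = ∑ i, aeval F (pderiv i h) * pderiv j (F i) := by
  classical
  induction h using MvPolynomial.induction_on with
  | C a => simp
  | add p q hp hq => simp only [map_add, hp, hq, add_mul, Finset.sum_add_distrib]
  | mul_X p i hp =>
    simp only [map_mul, aeval_X, Derivation.leibniz, hp, smul_eq_mul, map_add, add_mul,
      Finset.sum_add_distrib, Finset.mul_sum, pderiv_X]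
    congr 1
    · rw [Finset.sum_eq_single i]
      · simp
      · intro b _ hb; simp [Pi.single_apply, hb.symm]
      · simp
    · exact Finset.sum_congr rfl fun _ _ => by ring

lemma ti_chain_inv {N Q : ℕ} (F : Fin N → MvPolynomial (Fin N) ℂ)
    (h : MvPolynomial (Fin N) ℂ) (mu : ℂ) (hi : aeval F h = C mu * h ^ Q) (j : Fin N) :
    ∑ i, aeval F (pderiv i h) * pderiv j (F i) = C (mu * Q) * h ^ (Q - 1) * pderiv j h := by
  rw [← ti_chain, hi]
  simp [Derivation.leibniz, Derivation.leibniz_pow]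
  ring

lemma ti_hom_aeval_mul {σ B : Type*} [CommRing B] [Algebra ℂ B] (f : MvPolynomial σ ℂ) (e : ℕ)
    (hf : f.IsHomogeneous e) (x : σ → ℂ) (t : B) :
    aeval (fun j => t * algebraMap ℂ B (x j)) f = t ^ e * algebraMap ℂ B (eval x f) := by
  classical
  have h1 : aeval (fun j => t * algebraMap ℂ B (x j)) f = ∑ d ∈ f.support,
      algebraMap ℂ B (coeff d f) * d.prod fun j k => (t * algebraMap ℂ B (x j)) ^ k := by
    rw [aeval_def, eval₂_eq]; rfl
  have h2 : eval x f = ∑ d ∈ f.support, coeff d f * d.prod fun j k => x j ^ k := by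
    rw [eval_eq]; rfl
  rw [h1, h2, map_sum, Finset.mul_sum]
  refine Finset.sum_congr rfl fun d hd => ?_
  have hdeg : d.degree = e := by
    by_contra hne
    exact (mem_support_iff.1 hd) (hf.coeff_eq_zero hne)
  simp only [Finsupp.prod, map_mul, map_prod, map_pow, mul_pow, Finset.prod_mul_distrib]
  rw [Finset.prod_pow_eq_pow_sum]
  have : ∑ i ∈ d.support, d i = e := hdeg
  rw [this]
  ring

lemma ti_eval_smul {σ : Type*} (f : MvPolynomial σ ℂ) (e : ℕ)
    (hf : f.IsHomogeneous e) (x : σ → ℂ) (s : ℂ) : eval (s • x) f = s ^ e * eval x f := by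
  have := ti_hom_aeval_mul (B := ℂ) f e hf x s
  rw [aeval_eq_eval] at this
  exact this

/-- The linear form with coefficients `c`. -/
noncomputable def tiLin (N : ℕ) : (Fin N → ℂ) →ₗ[ℂ] MvPolynomial (Fin N) ℂ :=
  Fintype.linearCombination ℂ (X : Fin N → MvPolynomial (Fin N) ℂ)

lemma tiLin_apply {N : ℕ} (c : Fin N → ℂ) : tiLin N c = ∑ i, C (c i) * X i := by
  simp [tiLin, Fintype.linearCombination_apply, smul_eq_C_mul]

lemma tiLin_eval {N : ℕ} (c x : Fin N → ℂ) : eval x (tiLin N c) = ∑ i, c i * x i := by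
  simp [tiLin_apply]

lemma ti_dim_zero {N : ℕ} (e : ℕ) (he : 0 < e) (v : MvPolynomial (Fin N) ℂ) (hv : v.IsHomogeneous e)
    (x : Fin N → ℂ) (hx : eval x v ≠ 0) (J : Ideal (MvPolynomial (Fin N) ℂ)) (hvJ : v ∈ J)
    (hJ : ∀ c : Fin N → ℂ, ∑ i, c i * x i = 0 → tiLin N c ∈ J) :
    ringKrullDim (MvPolynomial (Fin N) ℂ ⧸ J) ≤ ((0 : ℕ) : WithBot ℕ∞) := by
  classical
  have hx0 : x ≠ 0 := by
    rintro rfl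
    apply hx
    have := ti_eval_smul v e hv 0 0
    rwa [smul_zero, zero_pow he.ne', zero_mul] at this
  obtain ⟨i, hi⟩ : ∃ i, x i ≠ 0 := by
    by_contra h; push Not at h; exact hx0 (funext h)
  have key : ∀ P : Ideal (MvPolynomial (Fin N) ℂ), P.IsPrime → J ≤ P →
      P = RingHom.ker (eval (0 : Fin N → ℂ)) := by
    intro P hP hJP
    let mk := Ideal.Quotient.mkₐ ℂ P
    let t := mk (X i) * algebraMap ℂ _ (x i)⁻¹
    have hj : ∀ j, mk (X j) = t * algebraMap ℂ _ (x j) := by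
      intro j
      have h1 : tiLin N (Pi.single j 1 - Pi.single i ((x i)⁻¹ * x j)) ∈ J := by
        apply hJ
        simp [sub_mul, Finset.sum_sub_distrib, Pi.single_apply]
        field_simp
        ring
      have h2 : mk (tiLin N (Pi.single j 1 - Pi.single i ((x i)⁻¹ * x j))) = 0 :=
        Ideal.Quotient.eq_zero_iff_mem.2 (hJP h1)
      have h3 : tiLin N (Pi.single j 1 - Pi.single i ((x i)⁻¹ * x j))
          = X j - C ((x i)⁻¹ * x j) * X i := by
        rw [map_sub]
        simp [tiLin, Fintype.linearCombination_apply_single, smul_eq_C_mul]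
      rw [h3, map_sub, sub_eq_zero] at h2
      rw [h2, map_mul, ← algebraMap_eq, AlgHom.commutes, map_mul]
      ring
    have hmk : mk = aeval (fun j => t * algebraMap ℂ _ (x j)) := by
      apply MvPolynomial.algHom_ext
      intro j; rw [aeval_X]; exact hj j
    have h4 : mk v = 0 := Ideal.Quotient.eq_zero_iff_mem.2 (hJP hvJ)
    rw [hmk, ti_hom_aeval_mul v e hv] at h4
    have : Nontrivial (MvPolynomial (Fin N) ℂ ⧸ P) := Ideal.Quotient.nontrivial_iff.2 hP.ne_top
    have ht : t = 0 := by
      rcases mul_eq_zero.1 h4 with h5 | h5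
      · exact (pow_eq_zero_iff he.ne').1 h5
      · exact absurd ((map_eq_zero (algebraMap ℂ (MvPolynomial (Fin N) ℂ ⧸ P))).1 h5) hx
    have hle : RingHom.ker (eval (0 : Fin N → ℂ)) ≤ P := by
      intro f hf
      apply Ideal.Quotient.eq_zero_iff_mem.1
      change mk f = 0
      have h6 : mk = (Algebra.ofId ℂ (MvPolynomial (Fin N) ℂ ⧸ P)).comp (aeval (0 : Fin N → ℂ)) := by
        apply MvPolynomial.algHom_ext
        intro j; rw [hj j, ht]; simp
      rw [h6, AlgHom.comp_apply, aeval_eq_eval]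
      rw [RingHom.mem_ker] at hf
      change algebraMap ℂ _ (eval (0 : Fin N → ℂ) f) = 0
      rw [hf, map_zero]
    have hmax : (RingHom.ker (eval (0 : Fin N → ℂ))).IsMaximal :=
      RingHom.ker_isMaximal_of_surjective _ (fun a => ⟨C a, by simp⟩)
    exact (hmax.eq_of_le hP.ne_top hle).symm
  rw [ringKrullDim_quotient]
  have : Subsingleton (PrimeSpectrum.zeroLocus (R := MvPolynomial (Fin N) ℂ) (J : Set _)) := by
    constructor
    rintro ⟨a, ha⟩ ⟨b, hb⟩
    apply Subtype.ext
    apply PrimeSpectrum.ext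
    change a.asIdeal = b.asIdeal
    rw [key a.asIdeal a.isPrime ha, key b.asIdeal b.isPrime hb]
  exact Order.krullDim_nonpos_of_subsingleton

lemma ti_extend {W : Type*} [AddCommGroup W] [Module ℂ W] (x : W) (hx : x ≠ 0)
    (k : ℕ) (hk : k + 1 ≤ Module.finrank ℂ W) :
    ∃ E : Fin (k + 1) → W, LinearIndependent ℂ E ∧ E 0 = x := by
  induction k with
  | zero =>
    haveI : Unique (Fin (0 + 1)) := inferInstanceAs (Unique (Fin 1))
    exact ⟨fun _ => x, linearIndependent_unique_iff.2 hx, rfl⟩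
  | succ k ih =>
    obtain ⟨E, hE, hE0⟩ := ih (by omega)
    obtain ⟨y, hy⟩ := exists_linearIndependent_snoc_of_lt_finrank hE (by omega)
    refine ⟨_, hy, ?_⟩
    have : (0 : Fin (k + 1 + 1)) = Fin.castSucc 0 := rfl
    rw [this, Fin.snoc_castSucc, hE0]

lemma ti_slice_data (m e : ℕ) (he : 0 < e) (P : Fin (m + 4) → MvPolynomial (Fin (m + 4)) ℂ)
    (hP : ∀ i, (P i).IsHomogeneous e)
    (hd : ringKrullDim (MvPolynomial (Fin (m + 4)) ℂ ⧸ Ideal.span (Set.range P)) ≤ (m : ℕ))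
    (Δ : MvPolynomial (Fin (m + 4)) ℂ) (hΔ : Δ ≠ 0) :
    ∃ (a : Fin 4 → Fin (m + 4) → ℂ) (E : Fin 4 → Fin (m + 4) → ℂ), eval (E 0) Δ ≠ 0 ∧
      eval (E 0) (∑ i, C (a 0 i) * P i) ≠ 0 ∧
      ∀ y : Fin 4 → ℂ, (∀ r, eval (fun j => ∑ k, y k * E k j) (∑ i, C (a r i) * P i) = 0) →
        y = 0 := by
  classical
  have hR : ringKrullDim (MvPolynomial (Fin (m + 4)) ℂ) = ((m + 4 : ℕ) : WithBot ℕ∞) := by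
    rw [MvPolynomial.ringKrullDim_of_isNoetherianRing, ringKrullDim_eq_zero_of_field]
    simp
  obtain ⟨v, hvV, hvd⟩ := ti_slice (Submodule.span ℂ (Set.range P)) m 4 ⊥
    ((ti_krull_mono ((Ideal.span_mono Submodule.subset_span).trans le_sup_right)).trans hd)
    ((ringKrullDim_quotient_le _).trans hR.le)
  rw [bot_sup_eq] at hvd
  -- reorder so that the first one is nonzero
  obtain ⟨r0, hr0⟩ : ∃ r, v r ≠ 0 := by
    by_contra hcon
    push Not at hcon
    have : Ideal.span (Set.range v) = ⊥ := by
      rw [Ideal.span_eq_bot]; rintro _ ⟨r, rfl⟩; exact hcon r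
    rw [this, ringKrullDim_eq_of_ringEquiv (RingEquiv.quotientBot _), hR] at hvd
    have : m + 4 ≤ m := Nat.cast_le.1 hvd
    omega
  obtain ⟨v', hv', hrange, hv0⟩ : ∃ v' : Fin 4 → MvPolynomial (Fin (m + 4)) ℂ,
      (∀ r, v' r ∈ Submodule.span ℂ (Set.range P)) ∧ Set.range v' = Set.range v ∧ v' 0 ≠ 0 :=
    ⟨v ∘ Equiv.swap 0 r0, fun r => hvV _, (Equiv.swap 0 r0).surjective.range_comp v, by simpa using hr0⟩
  rw [← hrange] at hvd
  have ha : ∀ r, ∃ a : Fin (m + 4) → ℂ, v' r = ∑ i, C (a i) * P i := by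
    intro r
    obtain ⟨a, ha⟩ := (Submodule.mem_span_range_iff_exists_fun ℂ).1 (hv' r)
    exact ⟨a, by rw [← ha]; simp [smul_eq_C_mul]⟩
  choose a ha using ha
  have hvh : ∀ r, (v' r).IsHomogeneous e := by
    intro r
    rw [ha]
    refine IsHomogeneous.sum _ _ _ fun i _ => ?_
    have := (isHomogeneous_C (Fin (m + 4)) (a r i)).mul (hP i)
    rwa [zero_add] at this
  obtain ⟨x, hx⟩ : ∃ x, eval x (v' 0 * Δ) ≠ 0 := by
    by_contra hcon
    push Not at hcon
    exact mul_ne_zero hv0 hΔ (MvPolynomial.funext fun x => by rw [hcon, map_zero])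
  rw [map_mul] at hx
  have hx1 := left_ne_zero_of_mul hx
  have hx2 := right_ne_zero_of_mul hx
  let φ : (Fin (m + 4) → ℂ) →ₗ[ℂ] ℂ := Fintype.linearCombination ℂ x
  have hφ : ∀ c, φ c = ∑ i, c i * x i := by
    intro c; simp [φ, Fintype.linearCombination_apply]
  obtain ⟨w, hwV, hwd⟩ := ti_slice ((LinearMap.ker φ).map (tiLin (m + 4))) 0 m
    (Ideal.span (Set.range v')) (by
      refine ti_dim_zero e he (v' 0) (hvh 0) x hx1 _
        (le_sup_left (a := Ideal.span (Set.range v')) (Ideal.subset_span ⟨0, rfl⟩)) ?_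
      intro c hc
      refine le_sup_right (a := Ideal.span (Set.range v')) (Ideal.subset_span ?_)
      exact ⟨c, by rw [SetLike.mem_coe, LinearMap.mem_ker, hφ, hc], rfl⟩) (by simpa using hvd)
  choose c hc hcw using hwV
  let Φ : (Fin (m + 4) → ℂ) →ₗ[ℂ] (Fin m → ℂ) :=
    (Matrix.of c).mulVecLin
  have hΦ : ∀ y, Φ y = fun k => ∑ i, c k i * y i := by
    intro y; rfl
  have hfr : 3 + 1 ≤ Module.finrank ℂ (LinearMap.ker Φ) := by
    have h1 := LinearMap.finrank_range_add_finrank_ker Φ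
    have h2 := Submodule.finrank_le (LinearMap.range Φ)
    simp only [Module.finrank_fin_fun] at h1 h2
    omega
  have hxk : x ∈ LinearMap.ker Φ := by
    rw [LinearMap.mem_ker, hΦ]
    funext k
    have := hc k
    rw [SetLike.mem_coe, LinearMap.mem_ker, hφ] at this
    exact this
  have hx0 : x ≠ 0 := by
    rintro rfl
    apply hx1
    have := ti_eval_smul (v' 0) e (hvh 0) 0 0
    rwa [smul_zero, zero_pow he.ne', zero_mul] at this
  obtain ⟨E, hE, hE0⟩ := ti_extend (⟨x, hxk⟩ : LinearMap.ker Φ)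
    (fun h => hx0 (congrArg Subtype.val h)) 3 hfr
  have hE0' : (E 0).1 = x := congrArg Subtype.val hE0
  refine ⟨a, fun k => (E k).1, by rw [← hE0'] at hx2; exact hx2,
    by rw [← hE0', ha] at hx1; exact hx1, ?_⟩
  intro y hy
  simp only [← ha] at hy
  let z : Fin (m + 4) → ℂ := ((∑ k, y k • E k : LinearMap.ker Φ) : Fin (m + 4) → ℂ)
  have hz : z = fun j => ∑ k, y k * (E k).1 j := by
    funext j; simp [z]
  rw [← hz] at hy
  have hzΦ : Φ z = 0 := (∑ k, y k • E k : LinearMap.ker Φ).2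
  have hz0 : z = 0 := by
    refine ti_no_zero _ z ?_ hwd
    intro f hf s
    have hle : Ideal.span (Set.range v') ⊔ Ideal.span (Set.range w) ≤ RingHom.ker (eval (s • z)) := by
      rw [sup_le_iff, Ideal.span_le, Ideal.span_le]
      constructor
      · rintro _ ⟨r, rfl⟩
        rw [SetLike.mem_coe, RingHom.mem_ker, ti_eval_smul _ e (hvh r), hy, mul_zero]
      · rintro _ ⟨k, rfl⟩
        rw [SetLike.mem_coe, RingHom.mem_ker, ← hcw, tiLin_eval]
        have := congrFun hzΦ k
        rw [hΦ] at this
        have h8 : ∑ i, c k i * (s • z) i = s * ∑ i, c k i * z i := by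
          rw [Finset.mul_sum]; exact Finset.sum_congr rfl fun i _ => by simp; ring
        rw [h8]
        change s * (fun k => ∑ i, c k i * z i) k = 0
        rw [this]; simp
    exact hle hf
  have h9 : (∑ k, y k • E k : LinearMap.ker Φ) = 0 := Subtype.ext hz0
  funext k
  exact Fintype.linearIndependent_iff.1 hE y h9 k

lemma ti_totalDegree_aeval {σ τ : Type*} (f : MvPolynomial σ ℂ) (g : σ → MvPolynomial τ ℂ)
    (hg : ∀ j, (g j).totalDegree ≤ 1) : (aeval g f).totalDegree ≤ f.totalDegree := by
  classical
  have h1 : aeval g f = ∑ d ∈ f.support, C (coeff d f) * d.prod fun j k => g j ^ k := by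
    rw [aeval_def, eval₂_eq]; rfl
  rw [h1]
  refine (totalDegree_finset_sum _ _).trans (Finset.sup_le fun d hd => ?_)
  refine (totalDegree_mul _ _).trans ?_
  rw [totalDegree_C, zero_add]
  refine le_trans ?_ (le_totalDegree hd)
  refine (totalDegree_finset_prod _ _).trans (Finset.sum_le_sum fun j _ => ?_)
  refine (totalDegree_pow _ _).trans ?_
  simpa using Nat.mul_le_mul_left (d j) (hg j)

lemma ti_complete (m : ℕ) (a : Fin 4 → Fin (m + 4) → ℂ) (ha : LinearIndependent ℂ a) :
    ∃ (B : Fin 4 ⊕ Fin m → Fin (m + 4) → ℂ) (β : Fin (m + 4) → Fin 4 ⊕ Fin m → ℂ),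
      (∀ r, B (Sum.inl r) = a r) ∧
      (∀ i l, ∑ k, β i k * B k l = if i = l then 1 else 0) ∧
      (∀ k k', ∑ i, B k i * β i k' = if k = k' then 1 else 0) := by
  classical
  let b := Module.Basis.sumExtend ha
  have hfin : Finite (Fin 4 ⊕ Module.Basis.sumExtendIndex ha) := Module.Finite.finite_basis b
  have hfin2 : Finite (Module.Basis.sumExtendIndex ha) := Finite.of_injective Sum.inr (Sum.inr_injective (α := Fin 4))
  have : Fintype (Module.Basis.sumExtendIndex ha) := Fintype.ofFinite _
  have hcard : Fintype.card (Module.Basis.sumExtendIndex ha) = m := by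
    have := Module.finrank_eq_card_basis b
    rw [Module.finrank_fin_fun, Fintype.card_sum, Fintype.card_fin] at this
    omega
  let eqv : Fin 4 ⊕ Module.Basis.sumExtendIndex ha ≃ Fin 4 ⊕ Fin m :=
    Equiv.sumCongr (Equiv.refl _) (Fintype.equivFinOfCardEq hcard)
  let b' := b.reindex eqv
  refine ⟨fun k => b' k, fun i k => b'.repr (Pi.single i 1) k, ?_, ?_, ?_⟩
  · intro r
    simp [b', b, eqv, Module.Basis.sumExtend]
    rfl
  · intro i l
    have := congrFun (b'.sum_repr (Pi.single i 1)) l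
    simp only [Finset.sum_apply, Pi.smul_apply, smul_eq_mul] at this
    rw [this, Pi.single_apply]
    simp [eq_comm]
  · intro k k'
    have h1 : b' k = ∑ i, b' k i • (Pi.single i (1 : ℂ) : Fin (m + 4) → ℂ) := by
      funext l; simp [Finset.sum_apply, Pi.single_apply]
    have h2 := congrArg (fun z => b'.repr z k') h1
    simp only [Module.Basis.repr_self, map_sum, map_smul, Finsupp.coe_finset_sum,
      Finset.sum_apply, Finsupp.smul_apply, smul_eq_mul, Finsupp.single_apply] at h2
    rw [← h2]

lemma ti_main_ineq_aux {K : Type*} [Field K] [Algebra ℂ K] [Algebra (MvPolynomial (Fin 3) ℂ) K]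
    [IsScalarTower ℂ (MvPolynomial (Fin 3) ℂ) K] [IsFractionRing (MvPolynomial (Fin 3) ℂ) K]
    (m Q d : ℕ) (hd2 : 2 ≤ d) (hdQ : d ≤ Q) (F : Fin (m + 4) → MvPolynomial (Fin (m + 4)) ℂ)
    (hF : IsEndo (m + 4) Q F) (h : MvPolynomial (Fin (m + 4)) ℂ) (hh : h.IsHomogeneous d)
    (mu : ℂ) (hi : aeval F h = C mu * h ^ Q)
    (hdim : ringKrullDim (MvPolynomial (Fin (m + 4)) ℂ ⧸
      Ideal.span (Set.range fun i => pderiv i h)) ≤ (m : ℕ)) :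
    (Q * (d - 1)) ^ 3 * Q ^ (m + 4) * (6 * m.factorial * (m + 4))
      ≤ (m + 4).factorial * Q ^ 3 * (Q + d + 2) ^ (m + 4) := by
  classical
  have hQ : 0 < Q := by omega
  have he : 0 < Q * (d - 1) := Nat.mul_pos hQ (by omega)
  let P : Fin (m + 4) → MvPolynomial (Fin (m + 4)) ℂ := fun i => aeval F (pderiv i h)
  have hPh : ∀ i, (P i).IsHomogeneous (Q * (d - 1)) := fun i => (hh.pderiv).aeval F hF.1
  have hPd : ringKrullDim (MvPolynomial (Fin (m + 4)) ℂ ⧸ Ideal.span (Set.range P)) ≤ (m : ℕ) := by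
    have h1 := ti_krull_map _ (ti_integral F Q hQ hF.1 hF.2)
      (Ideal.span (Set.range fun i => pderiv i h))
    rw [Ideal.map_span, ← Set.range_comp] at h1
    exact h1.trans hdim
  have hdet := ti_det_ne _ F Q hQ hF.1 hF.2
  set Δ := (Matrix.of fun i j => pderiv j (F i)).det with hΔ
  obtain ⟨a, E, hEΔ, hEv, hzero⟩ := ti_slice_data m _ he P hPh hPd Δ hdet
  let sl : MvPolynomial (Fin (m + 4)) ℂ →ₐ[ℂ] MvPolynomial (Fin 4) ℂ :=
    aeval (fun j => ∑ k, C (E k j) * X k)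
  let p : Fin 4 → MvPolynomial (Fin 4) ℂ := fun r => sl (∑ i, C (a r i) * P i)
  have hsl1 : ∀ j, (∑ k, C (E k j) * X k : MvPolynomial (Fin 4) ℂ).IsHomogeneous 1 := by
    intro j
    refine IsHomogeneous.sum _ _ _ fun k _ => ?_
    have := (isHomogeneous_C (Fin 4) (E k j)).mul (isHomogeneous_X ℂ k)
    rwa [zero_add] at this
  have hp : ∀ r, (p r).IsHomogeneous (Q * (d - 1)) := by
    intro r
    have h1 : (∑ i, C (a r i) * P i).IsHomogeneous (Q * (d - 1)) := by
      refine IsHomogeneous.sum _ _ _ fun i _ => ?_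
      have := (isHomogeneous_C (Fin (m + 4)) (a r i)).mul (hPh i)
      rwa [zero_add] at this
    have h2 := h1.aeval _ hsl1
    rwa [one_mul] at h2
  have hpz : ∀ y : Fin 4 → ℂ, (∀ r, eval y (p r) = 0) → y = 0 := by
    intro y hy
    apply hzero
    intro r
    rw [← hy r]
    simp only [p, sl]
    rw [ti_eval_aeval]
    congr 2
    funext j
    simp [mul_comm]
  have haLI : LinearIndependent ℂ a := by
    rw [Fintype.linearIndependent_iff]
    intro g hg
    by_contra hcon
    apply ti_det_ne 4 p _ he hp hpz
    apply Matrix.exists_vecMul_eq_zero_iff.1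
    refine ⟨fun r => C (g r), ?_, ?_⟩
    · intro h0
      apply hcon
      intro r
      have := congrFun h0 r
      simpa using this
    · have hsum : ∑ r, C (g r) * p r = 0 := by
        have h1 : ∑ r, C (g r) * p r = sl (∑ i, C (∑ r, g r * a r i) * P i) := by
          simp only [p, map_sum, map_mul, Finset.mul_sum, Finset.sum_mul]
          rw [Finset.sum_comm]
          refine Finset.sum_congr rfl fun i _ => Finset.sum_congr rfl fun r _ => ?_
          have : sl (C (g r)) = C (g r) := sl.commutes _
          rw [this]; ring
        rw [h1]
        have h2 : ∀ i, ∑ r, g r * a r i = 0 := by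
          intro i
          have := congrFun hg i
          simpa using this
        simp [h2]
      funext j
      have := congrArg (pderiv j) hsum
      simpa [Matrix.vecMul, dotProduct, Derivation.leibniz] using this
  obtain ⟨B, β, hBa, hβB, hBβ⟩ := ti_complete m a haLI
  let τ : MvPolynomial (Fin (m + 4)) ℂ →ₐ[ℂ] MvPolynomial (Fin 3) ℂ := tiDeh.comp sl
  have hτX : ∀ j, (τ (X j)).totalDegree ≤ 1 := by
    intro j
    have h1 : τ (X j) = tiDeh (∑ k, C (E k j) * X k) := by simp [τ, sl]
    rw [h1, tiDeh]
    refine (ti_totalDegree_aeval _ _ ?_).trans (hsl1 j).totalDegree_le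
    intro k
    refine Fin.cases ?_ ?_ k
    · simp
    · intro i; simp
  have hτaeval : τ = aeval (fun j => τ (X j)) := by
    apply MvPolynomial.algHom_ext; intro j; simp
  have hτdeg : ∀ f, (τ f).totalDegree ≤ f.totalDegree := by
    intro f
    rw [hτaeval]
    exact ti_totalDegree_aeval _ _ hτX
  have hτ0 : ∀ f, eval 0 (τ f) = eval (E 0) f := by
    intro f
    have h1 : (aeval (0 : Fin 3 → ℂ)).comp τ = aeval (E 0) := by
      apply MvPolynomial.algHom_ext
      intro j
      have h2 : τ (X j) = tiDeh (∑ k, C (E k j) * X k) := by simp [τ, sl]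
      rw [AlgHom.comp_apply, h2, Fin.sum_univ_succ]
      simp [tiDeh]
    have := AlgHom.congr_fun h1 f
    rw [AlgHom.comp_apply, aeval_eq_eval, aeval_eq_eval] at this
    exact this
  let am := algebraMap (MvPolynomial (Fin 3) ℂ) K
  have hinj : Function.Injective am := IsFractionRing.injective _ _
  let V : Fin 4 ⊕ Fin m → MvPolynomial (Fin (m + 4)) ℂ := fun k => ∑ l, C (B k l) * P l
  let row : Fin 4 ⊕ Fin m → Fin (m + 4) → MvPolynomial (Fin (m + 4)) ℂ :=
    fun k j => ∑ i, C (β i k) * pderiv j (F i)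
  have hVp : ∀ r, τ (V (Sum.inl r)) = tiDeh (p r) := by
    intro r
    simp only [V, hBa]
    rfl
  have hrowdeg : ∀ k j, (τ (row k j)).totalDegree ≤ Q := by
    intro k j
    refine (hτdeg _).trans ?_
    refine (totalDegree_finset_sum _ _).trans (Finset.sup_le fun i _ => ?_)
    refine (totalDegree_mul _ _).trans ?_
    rw [totalDegree_C, zero_add]
    exact ((hF.1 i).pderiv).totalDegree_le.trans (Nat.sub_le _ _)
  have hVrow : ∀ j, ∑ k, V k * row k j = C (mu * Q) * h ^ (Q - 1) * pderiv j h := by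
    intro j
    rw [← ti_chain_inv F h mu hi j]
    have h1 : ∀ i, P i = ∑ k, C (β i k) * V k := by
      intro i
      simp only [V, Finset.mul_sum]
      rw [Finset.sum_comm]
      have h2 : ∀ l, ∑ k, C (β i k) * (C (B k l) * P l) = C (if i = l then 1 else 0) * P l := by
        intro l
        rw [← hβB i l, map_sum, Finset.sum_mul]
        exact Finset.sum_congr rfl fun k _ => by rw [map_mul, mul_assoc]
      simp [h2]
    change _ = ∑ i, P i * pderiv j (F i)
    simp only [h1, row, Finset.mul_sum, Finset.sum_mul]
    rw [Finset.sum_comm]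
    exact Finset.sum_congr rfl fun i _ => Finset.sum_congr rfl fun k _ => by ring
  have hid : ∀ j, ∑ k, am (τ (V k)) * am (τ (row k j))
      = am (τ (C (mu * Q) * h ^ (Q - 1))) * am (τ (pderiv j h)) := by
    intro j
    have := congrArg (fun z => am (τ z)) (hVrow j)
    simpa only [map_sum, map_mul] using this
  -- nondegeneracy
  have hdetK : (Matrix.of fun i j => am (τ (pderiv j (F i)))).det ≠ 0 := by
    have h1 : (Matrix.of fun i j => am (τ (pderiv j (F i)))).det = am (τ Δ) := by
      rw [hΔ]
      change _ = (am.comp τ.toRingHom) _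
      rw [RingHom.map_det]
      rfl
    rw [h1]
    intro h2
    rw [← map_zero am] at h2
    apply hEΔ
    rw [← hτ0, hinj h2, map_zero]
  have hli : ∀ c : Fin 4 ⊕ Fin m → K, (∀ j, ∑ k, c k * am (τ (row k j)) = 0) → ∀ k, c k = 0 := by
    intro c hc
    let cc : Fin (m + 4) → K := fun i => ∑ k, c k * algebraMap ℂ K (β i k)
    have h1 : Matrix.vecMul cc (Matrix.of fun i j => am (τ (pderiv j (F i)))) = 0 := by
      funext j
      rw [Pi.zero_apply, ← hc j]
      simp only [Matrix.vecMul, dotProduct, cc, row, Matrix.of_apply, map_sum, map_mul,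
        Finset.mul_sum, Finset.sum_mul]
      rw [Finset.sum_comm]
      refine Finset.sum_congr rfl fun k _ => Finset.sum_congr rfl fun i _ => ?_
      have : am (τ (C (β i k))) = algebraMap ℂ K (β i k) := by
        have h2 : τ (C (β i k)) = algebraMap ℂ _ (β i k) := τ.commutes _
        rw [h2]
        exact (IsScalarTower.algebraMap_apply _ _ _ _).symm
      rw [this]; ring
    have h2 : cc = 0 := by
      by_contra hne
      exact hdetK (Matrix.exists_vecMul_eq_zero_iff.1 ⟨cc, hne, h1⟩)
    intro k
    have h3 : ∑ i, cc i * algebraMap ℂ K (B k i) = 0 := by simp [h2]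
    have h4 : ∑ i, cc i * algebraMap ℂ K (B k i)
        = ∑ k', c k' * algebraMap ℂ K (∑ i, B k i * β i k') := by
      simp only [cc, map_sum, map_mul, Finset.mul_sum, Finset.sum_mul]
      rw [Finset.sum_comm]
      exact Finset.sum_congr rfl fun i _ => Finset.sum_congr rfl fun k _ => by ring
    rw [h4] at h3
    simp only [hBβ] at h3
    simpa using h3
  have hp0 : am (tiDeh (p 0)) ≠ 0 := by
    intro h2
    rw [← map_zero am] at h2
    have h3 := hinj h2
    apply hEv
    have h4 := hτ0 (∑ i, C (a 0 i) * P i)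
    rw [← h4]
    change eval 0 (tiDeh (p 0)) = 0
    rw [h3, map_zero]
  have hp0' : tiDeh (p 0) ≠ 0 := fun h2 => hp0 (by rw [h2, map_zero])
  have hθ : am (τ (C (mu * Q) * h ^ (Q - 1))) ≠ 0 := by
    intro h2
    apply hp0
    have := hli (fun k => am (τ (V k))) (fun j => by rw [hid j, h2, zero_mul]) (Sum.inl 0)
    rw [← hVp 0]; exact this
  let u : Fin 3 → K := fun i => am (tiDeh (p i.succ)) / am (tiDeh (p 0))
  obtain ⟨halg, b, hb⟩ := ti_field_degree (K := K) p _ he hp hpz hp0' u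
    (fun i => div_mul_cancel₀ _ hp0)
  refine ti_core m Q d ((Q * (d - 1)) ^ 3) hdQ hQ (ι := Fin (m + 4)) (Fintype.card_fin _)
    (fun j => τ (row (Sum.inl 0) j)) (fun i j => τ (row (Sum.inl i.succ) j))
    (fun k j => τ (row (Sum.inr k) j)) (fun j => τ (pderiv j h))
    (fun j => hrowdeg _ _) (fun i j => hrowdeg _ _) (fun k j => hrowdeg _ _)
    (fun j => (hτdeg _).trans (hh.pderiv.totalDegree_le.trans (Nat.sub_le _ _)))
    (K := K) u (fun k => am (τ (V (Sum.inr k))) / am (tiDeh (p 0)))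
    (-(am (τ (C (mu * Q) * h ^ (Q - 1))) / am (tiDeh (p 0))))
    (neg_ne_zero.2 (div_ne_zero hθ hp0)) ?_ ?_ halg b hb
  · intro j
    have h1 := hid j
    rw [Fintype.sum_sum_type, Fin.sum_univ_succ] at h1
    simp only [hVp] at h1
    have h2 : ∀ x y z w θ g : K, x * y + z + w = θ * g → x ≠ 0 →
        y + x⁻¹ * z + x⁻¹ * w + -(θ / x) * g = 0 := by
      intro x y z w θ g hxy hx
      field_simp
      linear_combination hxy
    have h3 := h2 _ _ _ _ _ _ h1 hp0
    rw [← h3, Finset.mul_sum, Finset.mul_sum]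
    congr 2
    · congr 1
      exact Finset.sum_congr rfl fun i _ => by simp only [u, am]; ring
    · exact Finset.sum_congr rfl fun i _ => by simp only [am]; ring
  · intro c0 c c' hc
    have h1 := hli (Sum.elim (Fin.cons c0 c) c') (fun j => by
      rw [Fintype.sum_sum_type, Fin.sum_univ_succ]
      simpa using hc j)
    exact ⟨by simpa using h1 (Sum.inl 0), fun i => by simpa using h1 (Sum.inl i.succ),
      fun k => by simpa using h1 (Sum.inr k)⟩

lemma ti_main_ineq (m Q d : ℕ) (hd2 : 2 ≤ d) (hdQ : d ≤ Q)
    (F : Fin (m + 4) → MvPolynomial (Fin (m + 4)) ℂ)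
    (hF : IsEndo (m + 4) Q F) (h : MvPolynomial (Fin (m + 4)) ℂ) (hh : h.IsHomogeneous d)
    (mu : ℂ) (hi : aeval F h = C mu * h ^ Q)
    (hdim : ringKrullDim (MvPolynomial (Fin (m + 4)) ℂ ⧸
      Ideal.span (Set.range fun i => pderiv i h)) ≤ (m : ℕ)) :
    (Q * (d - 1)) ^ 3 * Q ^ (m + 4) * (6 * m.factorial * (m + 4))
      ≤ (m + 4).factorial * Q ^ 3 * (Q + d + 2) ^ (m + 4) :=
  ti_main_ineq_aux (K := FractionRing (MvPolynomial (Fin 3) ℂ)) m Q d hd2 hdQ F hF h hh mu hi hdim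

lemma ti_arith (m d Q : ℕ) (hQ : 1000 ≤ Q)
    (hnum : (m + 4).factorial * (1000 + d + 2) ^ (m + 4)
      < (d - 1) ^ 3 * 1000 ^ (m + 4) * (6 * m.factorial * (m + 4))) :
    (m + 4).factorial * Q ^ 3 * (Q + d + 2) ^ (m + 4)
      < (Q * (d - 1)) ^ 3 * Q ^ (m + 4) * (6 * m.factorial * (m + 4)) := by
  have h1 : (Q + d + 2) * 1000 ≤ (1000 + d + 2) * Q := by nlinarith
  have h2 := Nat.pow_le_pow_left h1 (m + 4)
  rw [mul_pow, mul_pow] at h2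
  have hQ0 : 0 < Q := by omega
  refine lt_of_mul_lt_mul_right ?_ (Nat.zero_le (1000 ^ (m + 4)))
  calc (m + 4).factorial * Q ^ 3 * (Q + d + 2) ^ (m + 4) * 1000 ^ (m + 4)
      = (m + 4).factorial * Q ^ 3 * ((Q + d + 2) ^ (m + 4) * 1000 ^ (m + 4)) := by ring
    _ ≤ (m + 4).factorial * Q ^ 3 * ((1000 + d + 2) ^ (m + 4) * Q ^ (m + 4)) :=
        Nat.mul_le_mul_left _ h2
    _ = Q ^ 3 * Q ^ (m + 4) * ((m + 4).factorial * (1000 + d + 2) ^ (m + 4)) := by ring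
    _ < Q ^ 3 * Q ^ (m + 4) * ((d - 1) ^ 3 * 1000 ^ (m + 4) * (6 * m.factorial * (m + 4))) :=
        Nat.mul_lt_mul_of_pos_left hnum (by positivity)
    _ = _ := by ring

lemma ti_lower (m d : ℕ) (hd2 : 2 ≤ d) (hd3 : d ≤ 1000)
    (hnum : (m + 4).factorial * (1000 + d + 2) ^ (m + 4)
      < (d - 1) ^ 3 * 1000 ^ (m + 4) * (6 * m.factorial * (m + 4)))
    (h : MvPolynomial (Fin (m + 4)) ℂ) (hh : h.IsHomogeneous d)
    (hinv : IsTotallyInvariant (m + 4) h) :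
    ¬ ringKrullDim (MvPolynomial (Fin (m + 4)) ℂ ⧸ jacobianIdeal (m + 4) h) ≤ (m : ℕ) := by
  intro hdim
  obtain ⟨q, hq, F, hF, lam, hlam, hi⟩ := hinv
  obtain ⟨G, hG, mu, _, hGi⟩ := ti_iter hF hlam hi 10
  have hQ : 1000 ≤ q ^ 10 := le_trans (by norm_num) (Nat.pow_le_pow_left hq 10)
  have hJ : jacobianIdeal (m + 4) h = Ideal.span (Set.range fun i => pderiv i h) := by
    unfold jacobianIdeal
    rw [Ideal.span_insert, sup_eq_right, Ideal.span_singleton_le_iff_mem]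
    have hE := hh.sum_X_mul_pderiv
    have h1 : h = C ((d : ℂ)⁻¹) * (d • h) := by
      rw [nsmul_eq_mul, ← mul_assoc, ← map_natCast (C : ℂ →+* MvPolynomial (Fin (m + 4)) ℂ), ← map_mul,
        inv_mul_cancel₀ (by exact_mod_cast (by omega : d ≠ 0)), map_one, one_mul]
    rw [h1, ← hE]
    refine Ideal.mul_mem_left _ _ (Ideal.sum_mem _ fun i _ => ?_)
    refine Ideal.mul_mem_left _ _ (Ideal.subset_span ?_)
    rw [hE, ← h1]
    exact ⟨i, rfl⟩
  rw [hJ] at hdim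
  have := ti_main_ineq m _ d hd2 (hd3.trans hQ) G hG h hh mu hGi hdim
  exact absurd (ti_arith m d _ hQ hnum) (not_lt.2 this)

lemma ti_upper (n d : ℕ) (hd : 0 < d) (h : MvPolynomial (Fin (n + 1)) ℂ) (hirr : Irreducible h)
    (hh : h.IsHomogeneous d) :
    ringKrullDim (MvPolynomial (Fin (n + 1)) ℂ ⧸ jacobianIdeal (n + 1) h) + 1 + 1
      ≤ ((n + 1 : ℕ) : WithBot ℕ∞) := by
  have hR : ringKrullDim (MvPolynomial (Fin (n + 1)) ℂ) = ((n + 1 : ℕ) : WithBot ℕ∞) := by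
    rw [MvPolynomial.ringKrullDim_of_isNoetherianRing, ringKrullDim_eq_zero_of_field]
    simp
  have hprime : Prime h := hirr.prime
  have hP : (Ideal.span {h}).IsPrime := (Ideal.span_singleton_prime hirr.ne_zero).2 hprime
  have h1 := ringKrullDim_quotient_succ_le_of_nonZeroDivisor
    (mem_nonZeroDivisors_of_ne_zero hirr.ne_zero)
  rw [hR] at h1
  obtain ⟨i, hi⟩ : ∃ i, pderiv i h ≠ 0 := by
    by_contra hcon
    push Not at hcon
    have hE := hh.sum_X_mul_pderiv
    simp only [hcon, mul_zero, Finset.sum_const_zero] at hE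
    rw [nsmul_eq_mul] at hE
    rcases mul_eq_zero.1 hE.symm with h2 | h2
    · have : d = 0 := by exact_mod_cast h2
      omega
    · exact hirr.ne_zero h2
  have hndvd : ¬ h ∣ pderiv i h := by
    intro hdvd
    have h2 := totalDegree_le_of_dvd_of_isDomain hdvd hi
    rw [hh.totalDegree hirr.ne_zero] at h2
    have h3 := (hh.pderiv (i := i)).totalDegree_le
    omega
  have hle : Ideal.span {h} ≤ jacobianIdeal (n + 1) h :=
    Ideal.span_mono (by simp)
  have h2 := ringKrullDim_succ_le_of_surjective (Ideal.Quotient.factor hle)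
    (Ideal.Quotient.factor_surjective hle) (r := Ideal.Quotient.mk _ (pderiv i h))
    (mem_nonZeroDivisors_of_ne_zero (by
      rw [Ne, Ideal.Quotient.eq_zero_iff_mem, Ideal.mem_span_singleton]
      exact hndvd)) (by
      rw [Ideal.Quotient.factor_mk, Ideal.Quotient.eq_zero_iff_mem]
      exact Ideal.subset_span (Set.mem_insert_of_mem _ ⟨i, rfl⟩))
  exact le_trans (by gcongr) h1

lemma ti_fin (n : ℕ) (hn : 3 ≤ n) (x : WithBot ℕ∞) (h1 : x + 1 + 1 ≤ ((n + 1 : ℕ) : WithBot ℕ∞))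
    (h2 : ¬ x ≤ ((n - 3 : ℕ) : WithBot ℕ∞)) :
    (x = ((n - 1 : ℕ) : WithBot ℕ∞) ∨ x = ((n - 2 : ℕ) : WithBot ℕ∞)) ∧
      ((n - 2 : ℕ) : WithBot ℕ∞) ≤ x := by
  induction x with
  | bot => exact absurd bot_le h2
  | coe y =>
    induction y with
    | top =>
      exfalso
      have : ((⊤ : ℕ∞) : WithBot ℕ∞) + 1 + 1 = ((⊤ : ℕ∞) : WithBot ℕ∞) := rfl
      rw [this] at h1
      have h3 : (⊤ : ℕ∞) ≤ ((n + 1 : ℕ) : ℕ∞) := WithBot.coe_le_coe.1 h1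
      exact absurd h3 (not_le.2 (ENat.natCast_lt_top _))
    | coe k =>
      have h1' : k + 1 + 1 ≤ n + 1 := by exact_mod_cast h1
      have hk : (((k : ℕ∞)) : WithBot ℕ∞) = ((k : ℕ) : WithBot ℕ∞) := rfl
      rw [hk] at h2 ⊢
      have h2' : ¬ k ≤ n - 3 := fun h5 => h2 (Nat.cast_le.2 h5)
      have h3 : k = n - 1 ∨ k = n - 2 := by omega
      have h4 : n - 2 ≤ k := by omega
      exact ⟨h3.imp (fun h5 => by rw [h5]) (fun h5 => by rw [h5]), Nat.cast_le.2 h4⟩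

/-- For `n ∈ {6, 7, 8}`, a totally invariant irreducible hypersurface of `ℙⁿ` of degree
`n - 2` has singular locus of dimension `n - 2` or `n - 3`: the Jacobian ring has Krull
dimension `n - 1` or `n - 2` (in particular `≥ n - 2`). -/
theorem degree_n_sub_two_small_n (n : ℕ) (hn : n = 6 ∨ n = 7 ∨ n = 8)
    (h : MvPolynomial (Fin (n + 1)) ℂ) (hirr : Irreducible h)
    (hhom : h.IsHomogeneous (n - 2)) (hinv : IsTotallyInvariant (n + 1) h) :
    (ringKrullDim (MvPolynomial (Fin (n + 1)) ℂ ⧸ jacobianIdeal (n + 1) h)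
        = ((n - 1 : ℕ) : WithBot ℕ∞) ∨
      ringKrullDim (MvPolynomial (Fin (n + 1)) ℂ ⧸ jacobianIdeal (n + 1) h)
        = ((n - 2 : ℕ) : WithBot ℕ∞)) ∧
    ((n - 2 : ℕ) : WithBot ℕ∞) ≤
      ringKrullDim (MvPolynomial (Fin (n + 1)) ℂ ⧸ jacobianIdeal (n + 1) h) := by
  refine ti_fin n (by omega) _ (ti_upper n (n - 2) (by omega) h hirr hhom) ?_
  rcases hn with rfl | rfl | rfl
  · exact ti_lower 3 4 (by norm_num) (by norm_num) (by norm_num [Nat.factorial]) h hhom hinv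
  · exact ti_lower 4 5 (by norm_num) (by norm_num) (by norm_num [Nat.factorial]) h hhom hinv
  · exact ti_lower 5 6 (by norm_num) (by norm_num) (by norm_num [Nat.factorial]) h hhom hinv
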